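/- For each n ≥ 1 let 𝓘_n denote the set of pairs (F, J) where F is an acyclic simple graph (forest) on the vertex set Fin n and J is a maximal independent set of F, let i_n = |𝓘_n|, let E_n = (Σ_{(F,J) ∈ 𝓘_n} |J|) / i_n, and let V_n = (Σ_{(F,J) ∈ 𝓘_n} |J|²) / i_n − E_n² be the variance of the size of a uniformly random element of 𝓘_n. Then there exist real constants σ² > 0 and K ≥ 0 such that |V_n − σ²·n| ≤ K for all n ≥ 1. -/

import Mathlib

open Filter Topology MeasureTheory

/-- `J` is an independent set of the simple graph `G`. -/
def IsIndepSet {V : Type*} (G : SimpleGraph V) (J : Set V) : Prop :=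
  ∀ ⦃u v : V⦄, u ∈ J → v ∈ J → ¬ G.Adj u v

/-- `J` is a maximal independent set of `G`. -/
def IsMaximalIndepSet {V : Type*} (G : SimpleGraph V) (J : Set V) : Prop :=
  IsIndepSet G J ∧ ∀ J' : Set V, IsIndepSet G J' → ¬ J ⊂ J'

/-- The pairs `(F, J)` where `F` is a forest (acyclic simple graph) on `Fin n`
and `J` is a maximal independent set of `F`. -/
def MISpace (n : ℕ) :=
  {p : SimpleGraph (Fin n) × Set (Fin n) // p.1.IsAcyclic ∧ IsMaximalIndepSet p.1 p.2}

/-- `iN n` is the number of pairs `(F, J)` where `F` is a forest on `Fin n`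
and `J` is a maximal independent set of `F`. -/
noncomputable def iN (n : ℕ) : ℕ := Nat.card (MISpace n)

/-- The expected size of a uniformly random maximal independent set–forest
pair on `n` vertices: the arithmetic mean of `|J|` over all pairs `(F, J)`. -/
noncomputable def En (n : ℕ) : ℝ :=
  (∑ᶠ p : MISpace n, (p.val.2.ncard : ℝ)) / (iN n : ℝ)

/-- The variance of the size of a uniformly random maximal independent
set–forest pair on `n` vertices. -/
noncomputable def Vn (n : ℕ) : ℝ :=
  (∑ᶠ p : MISpace n, (p.val.2.ncard : ℝ) ^ 2) / (iN n : ℝ) - (En n) ^ 2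

namespace SimpleGraph

variable {V : Type*}

/-- The graph obtained from `G` by adding a vertex `none` whose neighbours are the elements
of `N`. -/
def addVertex (G : SimpleGraph V) (N : Set V) : SimpleGraph (Option V) where
  Adj x y := match x, y with
    | none, none => False
    | none, some v => v ∈ N
    | some v, none => v ∈ N
    | some v, some w => G.Adj v w
  symm := ⟨by
    rintro (_ | v) (_ | w) h
    exacts [h, h, h, G.adj_symm h]⟩
  loopless := ⟨by
    rintro (_ | v) h
    exacts [h, G.irrefl h]⟩

/-- Distinct elements of `R` lie in distinct components of `G`. -/
def Separates (G : SimpleGraph V) (R : Set V) : Prop :=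
  ∀ ⦃v⦄, v ∈ R → ∀ ⦃w⦄, w ∈ R → G.Reachable v w → v = w

variable {G : SimpleGraph V} {N : Set V}

@[simp] lemma addVertex_adj_none_some {v : V} : (G.addVertex N).Adj none (some v) ↔ v ∈ N := Iff.rfl

@[simp] lemma addVertex_adj_some_none {v : V} : (G.addVertex N).Adj (some v) none ↔ v ∈ N := Iff.rfl

@[simp] lemma addVertex_adj_some_some {v w : V} :
    (G.addVertex N).Adj (some v) (some w) ↔ G.Adj v w := Iff.rfl

@[simp] lemma addVertex_adj_none_none : ¬ (G.addVertex N).Adj none none := id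

lemma addVertex_comap_some (G : SimpleGraph (Option V)) :
    (G.comap some).addVertex {v | G.Adj none (some v)} = G := by
  ext x y
  rcases x with _ | x <;> rcases y with _ | y <;> simp [G.adj_comm]

lemma Reachable.addVertex {v w : V} (h : G.Reachable v w) :
    (G.addVertex N).Reachable (some v) (some w) :=
  h.map ⟨some, id⟩

lemma addVertex_reachable_none_some {w : V} :
    (G.addVertex N).Reachable none (some w) ↔ ∃ n ∈ N, G.Reachable n w := by
  constructor
  · rw [reachable_iff_reflTransGen]
    suffices ∀ y, Relation.ReflTransGen (G.addVertex N).Adj none y →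
        ∀ w, y = some w → ∃ n ∈ N, G.Reachable n w from fun h ↦ this _ h w rfl
    intro y h
    induction h with
    | refl => simp
    | @tail x y _ h ih =>
      rintro w rfl
      rcases x with _ | x
      · exact ⟨w, h, .rfl⟩
      · obtain ⟨n, hn, hr⟩ := ih x rfl
        exact ⟨n, hn, hr.trans (Adj.reachable h)⟩
  · rintro ⟨n, hn, hr⟩
    exact (Adj.reachable (G := G.addVertex N) (u := none) (v := some n) hn).trans hr.addVertex

lemma addVertex_reachable_some_some {v w : V} :
    (G.addVertex N).Reachable (some v) (some w) ↔
      G.Reachable v w ∨ (∃ n ∈ N, G.Reachable n v) ∧ ∃ n ∈ N, G.Reachable n w := by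
  constructor
  · rw [reachable_iff_reflTransGen]
    suffices ∀ y, Relation.ReflTransGen (G.addVertex N).Adj (some v) y →
        (∀ w, y = some w →
          G.Reachable v w ∨ (∃ n ∈ N, G.Reachable n v) ∧ ∃ n ∈ N, G.Reachable n w) ∧
        (y = none → ∃ n ∈ N, G.Reachable n v) from fun h ↦ (this _ h).1 w rfl
    intro y h
    induction h with
    | refl => simp
    | @tail x y _ h ih =>
      rcases x with _ | x
      · refine ⟨?_, fun _ ↦ ih.2 rfl⟩
        rintro w rfl
        exact .inr ⟨ih.2 rfl, w, h, .rfl⟩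
      · refine ⟨?_, ?_⟩
        · rintro w rfl
          have hxw : G.Reachable x w := Adj.reachable h
          rcases ih.1 x rfl with h1 | ⟨h1, n, hn, h2⟩
          · exact .inl (h1.trans hxw)
          · exact .inr ⟨h1, n, hn, h2.trans hxw⟩
        · rintro rfl
          rcases ih.1 x rfl with h1 | ⟨h1, -⟩
          · exact ⟨x, h, h1.symm⟩
          · exact h1
  · rintro (h | ⟨h1, h2⟩)
    · exact h.addVertex
    · rw [← addVertex_reachable_none_some] at h1 h2
      exact h1.symm.trans h2

lemma isAcyclic_addVertex_empty : (G.addVertex ∅).IsAcyclic ↔ G.IsAcyclic := by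
  refine ⟨fun h ↦ h.comap (⟨some, id⟩ : G →g G.addVertex ∅) (Option.some_injective V), fun h ↦ ?_⟩
  rw [isAcyclic_iff_forall_adj_isBridge] at h ⊢
  rintro (_ | v) (_ | w) hvw
  · exact hvw.elim
  · exact hvw.elim
  · exact hvw.elim
  · have := h hvw
    rw [isBridge_iff] at this ⊢
    have heq : (G.addVertex ∅).deleteEdges {s(some v, some w)} =
        (G.deleteEdges {s(v, w)}).addVertex ∅ := by
      ext x y
      rcases x with _ | x <;> rcases y with _ | y <;> simp
    rw [heq, addVertex_reachable_some_some]
    simpa using this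

lemma isAcyclic_addVertex [Finite V] :
    (G.addVertex N).IsAcyclic ↔ G.IsAcyclic ∧ G.Separates N := by
  induction N, N.toFinite using Set.Finite.induction_on with
  | empty => simp [isAcyclic_addVertex_empty, Separates]
  | @insert n N hn _ ih =>
    have heq : G.addVertex (insert n N) = G.addVertex N ⊔ edge none (some n) := by
      ext x y
      rcases x with _ | x <;> rcases y with _ | y <;> simp [edge_adj, or_comm]
    rw [heq, isAcyclic_sup_fromEdgeSet_iff, ih, addVertex_reachable_none_some]
    simp only [reduceCtorEq, addVertex_adj_none_some, hn, false_or, imp_false, not_exists, not_and,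
      and_assoc, and_congr_right_iff]
    refine fun _ ↦ ⟨?_, fun h ↦ ⟨?_, ?_⟩⟩
    · rintro ⟨h, h'⟩ v (rfl | hv) w (rfl | hw) hvw
      · rfl
      · exact (h' _ hw hvw.symm).elim
      · exact (h' _ hv hvw).elim
      · exact h hv hw hvw
    · exact fun v hv w hw ↦ h (.inr hv) (.inr hw)
    · rintro m hm hr
      exact hn (h (.inr hm) (.inl rfl) hr ▸ hm)

lemma isAcyclic_and_separates_addVertex [Finite V] {R : Set (Option V)} (hR : none ∈ R) :
    (G.addVertex N).IsAcyclic ∧ (G.addVertex N).Separates R ↔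
      Disjoint N (some ⁻¹' R) ∧ G.IsAcyclic ∧ G.Separates (N ∪ some ⁻¹' R) := by
  rw [isAcyclic_addVertex, Set.disjoint_left]
  constructor
  · rintro ⟨⟨h, hN⟩, hs⟩
    have key : ∀ n ∈ N, ∀ r, some r ∈ R → ¬ G.Reachable n r := fun n hn r hr hnr ↦ by
      simpa using hs hR hr (addVertex_reachable_none_some.2 ⟨n, hn, hnr⟩)
    refine ⟨fun n hn hr ↦ key n hn n hr .rfl, h, ?_⟩
    rintro v (hv | hv) w (hw | hw) hvw
    · exact hN hv hw hvw
    · exact (key _ hv _ hw hvw).elim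
    · exact (key _ hw _ hv hvw.symm).elim
    · exact Option.some_injective _ (hs hv hw hvw.addVertex)
  · rintro ⟨hd, h, hs⟩
    have key : ∀ n ∈ N, ∀ r, some r ∈ R → ¬ G.Reachable n r := fun n hn r hr hnr ↦
      hd hn (hs (.inl hn) (.inr hr) hnr ▸ hr)
    refine ⟨⟨h, fun v hv w hw ↦ hs (.inl hv) (.inl hw)⟩, ?_⟩
    rintro (_ | v) hv (_ | w) hw hvw
    · rfl
    · obtain ⟨n, hn, hr⟩ := addVertex_reachable_none_some.1 hvw
      exact (key n hn w hw hr).elim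
    · obtain ⟨n, hn, hr⟩ := addVertex_reachable_none_some.1 hvw.symm
      exact (key n hn v hv hr).elim
    · rcases addVertex_reachable_some_some.1 hvw with hr | ⟨⟨n, hn, hr⟩, -⟩
      · rw [hs (.inr hv) (.inr hw) hr]
      · exact (key n hn v hv hr).elim

end SimpleGraph

/-- The roles a vertex can play in a forest with a distinguished vertex set `J`. Unless it is
`free`, a vertex is a root, and no other root belongs to its component. -/
inductive Mark
  | free
  | either
  | inside
  | outside
  | dominated
  | undominated

/-- The condition a mark imposes on a vertex, in terms of its membership in `J` (the proposition
`p`) and of the existence of a neighbour in `J` (the proposition `q`). -/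
def Mark.Allows : Mark → Prop → Prop → Prop
  | free, p, q => p ↔ ¬ q
  | either, p, q => p ↔ ¬ q
  | inside, p, q => p ∧ ¬ q
  | outside, p, _ => ¬ p
  | dominated, p, q => ¬ p ∧ q
  | undominated, p, q => ¬ p ∧ ¬ q

/-- `κ.Spawns κ'` means that, when a root marked `κ` is deleted, its neighbours become roots
marked `κ'`. -/
inductive Mark.Spawns : Mark → Mark → Prop
  | inside : Spawns inside outside
  | outside : Spawns outside either
  | undominated : Spawns undominated dominated

/-- `G` is a forest whose components contain at most one root, and `J` is a set of vertices
compatible with all marks. -/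
structure IsMarkedForest {V : Type*} (c : V → Mark) (G : SimpleGraph V) (J : Set V) : Prop where
  isAcyclic : G.IsAcyclic
  separates : G.Separates {v | c v ≠ .free}
  allows (v : V) : (c v).Allows (v ∈ J) (∃ w ∈ J, G.Adj v w)

open scoped Classical in
/-- The number of pairs `(G, J)` compatible with the marks `c`, counted with weight `u ^ |J|`. -/
noncomputable def markedCount {V : Type*} [Fintype V] (u : ℂ) (c : V → Mark) : ℂ :=
  ∑ p : SimpleGraph V × Set V with IsMarkedForest c p.1 p.2, ∏ v, if v ∈ p.2 then u else 1

section markedCount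

variable {V W : Type*}

lemma IsMarkedForest.comap_equiv {e : V ≃ W} {c : W → Mark} {G : SimpleGraph V} {J : Set V}
    (h : IsMarkedForest (c ∘ e) G J) : IsMarkedForest c (G.comap e.symm) (e.symm ⁻¹' J) := by
  refine ⟨h.1.comap ⟨e.symm, id⟩ e.symm.injective, fun v hv w hw hvw ↦ ?_, fun v ↦ ?_⟩
  · refine e.symm.injective (h.2 (v := e.symm v) ?_ (w := e.symm w) ?_ (hvw.map ⟨e.symm, id⟩))
    · simpa using hv
    · simpa using hw
  · have := h.3 (e.symm v)
    rw [e.symm.surjective.exists] at this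
    simpa using this

lemma isMarkedForest_comp_equiv (e : V ≃ W) (c : W → Mark) (G : SimpleGraph V) (J : Set V) :
    IsMarkedForest (c ∘ e) G J ↔ IsMarkedForest c (G.comap e.symm) (e.symm ⁻¹' J) := by
  refine ⟨.comap_equiv, fun h ↦ ?_⟩
  have hc : (c ∘ e) ∘ e.symm = c := by ext; simp
  convert! IsMarkedForest.comap_equiv (e := e.symm) (c := c ∘ e) (hc.symm ▸ h)
  · ext; simp
  · ext; simp

variable [Fintype V] [Fintype W]

lemma markedCount_comp_equiv (e : V ≃ W) (u : ℂ) (c : W → Mark) :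
    markedCount u (c ∘ e) = markedCount u c := by
  classical
  refine Finset.sum_nbij' (fun p ↦ (p.1.comap e.symm, e.symm ⁻¹' p.2))
    (fun p ↦ (p.1.comap e, e ⁻¹' p.2)) ?_ ?_ ?_ ?_ ?_
  · intro p hp
    simpa [isMarkedForest_comp_equiv] using hp
  · intro p hp
    simp only [Finset.mem_filter_univ] at hp ⊢
    rw [isMarkedForest_comp_equiv]
    convert! hp <;> ext <;> simp
  · intro p _
    ext <;> simp
  · intro p _
    ext <;> simp
  · intro p _
    exact Fintype.prod_equiv e _ _ (by simp)

lemma isMarkedForest_addVertex {c : Option V → Mark} {κ : Mark} (h : (c none).Spawns κ)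
    (G : SimpleGraph V) (N : Finset V) (J : Set (Option V)) [DecidableEq V] :
    IsMarkedForest c (G.addVertex N) J ↔
      (∀ v ∈ N, c (some v) = .free) ∧ (none ∈ J ↔ c none = .inside) ∧
        IsMarkedForest (fun v ↦ if v ∈ N then κ else c (some v)) G (some ⁻¹' J) := by
  have hnone : c none ≠ .free := by generalize c none = κ₀ at h; cases h <;> simp
  have hκ : κ ≠ .free := by generalize c none = κ₀ at h; cases h <;> simp
  have h1 := SimpleGraph.isAcyclic_and_separates_addVertex (G := G) (N := N)
    (R := {v | c v ≠ .free}) hnone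
  have h2 : Disjoint (N : Set V) (some ⁻¹' {v | c v ≠ .free}) ↔
      ∀ v ∈ N, c (some v) = .free := by
    simp [Set.disjoint_left]
  have h3 : (N ∪ some ⁻¹' {v | c v ≠ .free} : Set V) =
      {v | (if v ∈ N then κ else c (some v)) ≠ .free} := by
    ext v
    by_cases hv : v ∈ N <;> simp [hv, hκ]
  have h4 : (∀ v ∈ N, c (some v) = .free) →
      ((∀ v, (c v).Allows (v ∈ J) (∃ w ∈ J, (G.addVertex N).Adj v w)) ↔
      (none ∈ J ↔ c none = .inside) ∧ ∀ v, (if v ∈ N then κ else c (some v)).Allows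
        (v ∈ some ⁻¹' J) (∃ w ∈ some ⁻¹' J, G.Adj v w)) := by
    intro hN
    simp only [Option.forall, Option.exists, SimpleGraph.addVertex_adj_none_none,
      SimpleGraph.addVertex_adj_none_some, SimpleGraph.addVertex_adj_some_none,
      SimpleGraph.addVertex_adj_some_some, and_false, false_or, Finset.mem_coe, Set.mem_preimage]
    have hsplit : ∀ P : V → Prop, (∀ v, P v) ↔ (∀ v ∈ N, P v) ∧ ∀ v, v ∉ N → P v := fun P ↦
      ⟨fun h ↦ ⟨fun v _ ↦ h v, fun v _ ↦ h v⟩, fun h v ↦ (em (v ∈ N)).elim (h.1 v) (h.2 v)⟩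
    rw [hsplit, hsplit (fun v ↦ (if v ∈ N then κ else c (some v)).Allows _ _)]
    have e1 : ∀ Q : V → Prop, (∀ v, v ∉ N → (c (some v)).Allows (some v ∈ J)
        (none ∈ J ∧ v ∈ N ∨ Q v)) ↔
        ∀ v, v ∉ N → (if v ∈ N then κ else c (some v)).Allows (some v ∈ J) (Q v) := fun Q ↦
      forall₂_congr fun v hv ↦ by simp [hv]
    rw [e1, ← and_assoc, ← and_assoc]
    refine and_congr_left fun _ ↦ ?_
    have e2 : ∀ Q : V → Prop, (∀ v ∈ N, (c (some v)).Allows (some v ∈ J)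
        (none ∈ J ∧ v ∈ N ∨ Q v)) ↔ ∀ v ∈ N, (some v ∈ J ↔ ¬ (none ∈ J ∨ Q v)) := fun Q ↦
      forall₂_congr fun v hv ↦ by simp [hv, hN v hv, Mark.Allows]
    have e3 : ∀ Q : V → Prop, (∀ v ∈ N, (if v ∈ N then κ else c (some v)).Allows (some v ∈ J)
        (Q v)) ↔ ∀ v ∈ N, κ.Allows (some v ∈ J) (Q v) := fun Q ↦
      forall₂_congr fun v hv ↦ by simp [hv]
    rw [e2, e3]
    generalize c none = κ₀ at h
    cases h <;> simp only [Mark.Allows] <;> grind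
  constructor
  · rintro ⟨ha, hs, hall⟩
    obtain ⟨hd, ha', hs'⟩ := h1.1 ⟨ha, hs⟩
    rw [h2] at hd
    obtain ⟨hJ, hall'⟩ := (h4 hd).1 hall
    exact ⟨hd, hJ, ha', h3 ▸ hs', hall'⟩
  · rintro ⟨hd, hJ, ha, hs, hall⟩
    obtain ⟨ha', hs'⟩ := h1.2 ⟨h2.2 hd, ha, h3 ▸ hs⟩
    exact ⟨ha', hs', (h4 hd).2 ⟨hJ, hall⟩⟩

open scoped Classical in
lemma markedCount_option {c : Option V → Mark} {κ : Mark} (h : (c none).Spawns κ) (u : ℂ) :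
    markedCount u c = (if c none = .inside then u else 1) *
      ∑ N ∈ (Finset.univ.filter fun v ↦ c (some v) = .free).powerset,
        markedCount u fun v ↦ if v ∈ N then κ else c (some v) := by
  unfold markedCount
  simp only [Finset.mul_sum]
  rw [Finset.sum_sigma']
  refine Finset.sum_nbij'
    (fun p ↦ ⟨Finset.univ.filter fun v ↦ p.1.Adj none (some v), p.1.comap some, some ⁻¹' p.2⟩)
    (fun q ↦ (q.2.1.addVertex q.1, {x | x.elim (c none = .inside) (· ∈ q.2.2)})) ?_ ?_ ?_ ?_ ?_
  · rintro ⟨G, J⟩ hp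
    simp only [Finset.mem_filter_univ] at hp
    rw [← G.addVertex_comap_some, ← Finset.coe_filter_univ, isMarkedForest_addVertex h] at hp
    simp only [Finset.mem_sigma, Finset.mem_powerset, Finset.mem_filter_univ]
    exact ⟨fun v hv ↦ by simpa using hp.1 v hv, by simpa using hp.2.2⟩
  · rintro ⟨N, G, J⟩ hp
    simp only [Finset.mem_sigma, Finset.mem_powerset, Finset.mem_filter_univ] at hp ⊢
    rw [isMarkedForest_addVertex h]
    exact ⟨fun v hv ↦ by simpa using hp.1 hv, by simp, hp.2⟩
  · rintro ⟨G, J⟩ hp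
    simp only [Finset.mem_filter_univ] at hp
    have hG := G.addVertex_comap_some
    rw [← hG, ← Finset.coe_filter_univ, isMarkedForest_addVertex h] at hp
    ext x y
    · simpa using by rw [hG]
    · cases x <;> simp [hp.2.1]
  · rintro ⟨N, G, J⟩ hp
    simp
    ext
    simp
  · rintro ⟨G, J⟩ hp
    simp only [Finset.mem_filter_univ] at hp
    rw [← G.addVertex_comap_some, ← Finset.coe_filter_univ, isMarkedForest_addVertex h] at hp
    simp [Fintype.prod_option, hp.2.1]

lemma markedCount_eq_add [DecidableEq V] {c : V → Mark} {r : V} {κ₁ κ₂ : Mark}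
    (hr : c r = .outside ∧ κ₁ = .dominated ∧ κ₂ = .undominated ∨
      c r = .either ∧ κ₁ = .inside ∧ κ₂ = .dominated) (u : ℂ) :
    markedCount u c =
      markedCount u (Function.update c r κ₁) + markedCount u (Function.update c r κ₂) := by
  classical
  unfold markedCount
  have hfree : ∀ κ ≠ Mark.free, {v | Function.update c r κ v ≠ .free} = {v | c v ≠ .free} := by
    intro κ hκ
    ext v
    by_cases hv : v = r
    · subst hv
      rcases hr with ⟨h, -, -⟩ | ⟨h, -, -⟩ <;> simp [h, hκ]
    · simp [hv]
  have hupd : ∀ κ ≠ Mark.free, ∀ G J, IsMarkedForest (Function.update c r κ) G J ↔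
      (G.IsAcyclic ∧ G.Separates {v | c v ≠ .free} ∧
        ∀ v ≠ r, (c v).Allows (v ∈ J) (∃ w ∈ J, G.Adj v w)) ∧
      κ.Allows (r ∈ J) (∃ w ∈ J, G.Adj r w) := by
    intro κ hκ G J
    constructor
    · rintro ⟨h1, h2, h3⟩
      refine ⟨⟨h1, hfree κ hκ ▸ h2, fun v hv ↦ ?_⟩, ?_⟩
      · simpa [hv] using h3 v
      · simpa using h3 r
    · rintro ⟨⟨h1, h2, h3⟩, h4⟩
      refine ⟨h1, (hfree κ hκ).symm ▸ h2, fun v ↦ ?_⟩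
      by_cases hv : v = r
      · subst hv
        simpa using h4
      · simpa [hv] using h3 v hv
  have h0 := hupd (c r) (by rcases hr with ⟨h, -⟩ | ⟨h, -⟩ <;> simp [h])
  have h1 := hupd κ₁ (by rcases hr with ⟨-, h, -⟩ | ⟨-, h, -⟩ <;> simp [h])
  have h2 := hupd κ₂ (by rcases hr with ⟨-, -, h⟩ | ⟨-, -, h⟩ <;> simp [h])
  rw [Function.update_eq_self] at h0
  rw [← Finset.sum_union]
  · congr 1
    ext ⟨G, J⟩
    simp only [Finset.mem_union, Finset.mem_filter_univ, h0, h1, h2, ← and_or_left]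
    refine and_congr_right fun _ ↦ ?_
    generalize (∃ w ∈ J, G.Adj r w) = q
    rcases hr with ⟨h, h', h''⟩ | ⟨h, h', h''⟩ <;> simp only [h, h', h'', Mark.Allows] <;> tauto
  · rw [Finset.disjoint_left]
    rintro ⟨G, J⟩
    simp only [Finset.mem_filter_univ, h1, h2]
    rintro ⟨-, h3⟩ ⟨-, h4⟩
    generalize (∃ w ∈ J, G.Adj r w) = q at h3 h4
    rcases hr with ⟨h, h', h''⟩ | ⟨h, h', h''⟩ <;> simp only [h', h'', Mark.Allows] at h3 h4 <;>
      tauto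

lemma markedCount_free [DecidableEq V] {c : V → Mark} (hc : ∀ v, c v = .free) (r : V) (u : ℂ) :
    markedCount u c = markedCount u (Function.update c r .either) := by
  classical
  unfold markedCount
  congr 1
  ext ⟨G, J⟩
  simp only [Finset.mem_filter_univ]
  have h1 : G.Separates {v | c v ≠ .free} := by simp [hc, SimpleGraph.Separates]
  have h2 : G.Separates {v | Function.update c r .either v ≠ .free} := by
    have : ∀ v, Function.update c r .either v ≠ .free → v = r := by
      intro v hv
      by_contra h
      simp [h, hc] at hv
    intro v hv w hw _
    rw [this v hv, this w hw]
  have h3 : ∀ v p q, (c v).Allows p q ↔ (Function.update c r .either v).Allows p q := by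
    intro v p q
    by_cases h : v = r
    · subst h
      simp [hc, Mark.Allows]
    · simp [h]
  constructor
  · rintro ⟨h, -, h'⟩
    exact ⟨h, h2, fun v ↦ (h3 v _ _).1 (h' v)⟩
  · rintro ⟨h, -, h'⟩
    exact ⟨h, h1, fun v ↦ (h3 v _ _).2 (h' v)⟩

lemma markedCount_of_isEmpty [IsEmpty V] (c : V → Mark) (u : ℂ) : markedCount u c = 1 := by
  classical
  have h : ∀ p : SimpleGraph V × Set V, IsMarkedForest c p.1 p.2 := fun p ↦
    ⟨.of_subsingleton, fun v ↦ isEmptyElim v, fun v ↦ isEmptyElim v⟩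
  simp [markedCount, h]

end markedCount

/-- The exponential generating function, in the variable `t`, of the trees rooted at a vertex of
the distinguished set. -/
noncomputable def insideSeries (u t : ℂ) : ℂ := u * t * Complex.exp t

/-- The exponential generating function of the trees rooted at a vertex outside of the
distinguished set and subject to no other condition. -/
noncomputable def outsideSeries (u t : ℂ) : ℂ := t * Complex.exp (insideSeries u t)

/-- The exponential generating function of the trees rooted at a vertex outside of the
distinguished set with a neighbour in it. -/
noncomputable def dominatedSeries (u t : ℂ) : ℂ := outsideSeries u t - t

/-- The logarithmic derivative `t ∂/∂t` of `exp (dominatedSeries u t)`. -/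
noncomputable def eulerDominated (u t : ℂ) : ℂ :=
  outsideSeries u t * (1 + insideSeries u t * (1 + t)) - t

/-- The exponential generating function of unrooted trees. -/
noncomputable def treeSeries (u t : ℂ) : ℂ :=
  insideSeries u t + dominatedSeries u t - insideSeries u t * outsideSeries u t
    - dominatedSeries u t ^ 2 / 2

/-- The factor contributed by a vertex with a given mark. -/
noncomputable def markWeight (u t : ℂ) : Mark → ℂ
  | .free => 1
  | .either => u * Complex.exp (outsideSeries u t) +
      (Complex.exp (insideSeries u t + dominatedSeries u t) - Complex.exp (dominatedSeries u t))
  | .inside => u * Complex.exp (outsideSeries u t)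
  | .outside => Complex.exp (insideSeries u t + dominatedSeries u t)
  | .dominated =>
      Complex.exp (insideSeries u t + dominatedSeries u t) - Complex.exp (dominatedSeries u t)
  | .undominated => Complex.exp (dominatedSeries u t)

/-- The product of `t` and `exp (-dominatedSeries u t)`, whose compositional inverse in `t` is the
exponential generating function of trees with an undominated root. -/
noncomputable def sizeSeries (u t : ℂ) : ℂ := t * Complex.exp (-dominatedSeries u t)

section series

variable (u t : ℂ)

lemma sizeSeries_mul_either :
    sizeSeries u t * markWeight u t .either = insideSeries u t + dominatedSeries u t := by
  have h1 : Complex.exp (-dominatedSeries u t) * Complex.exp (outsideSeries u t) =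
      Complex.exp t := by
    rw [← Complex.exp_add, dominatedSeries]; congr 1; ring
  have h2 : Complex.exp (-dominatedSeries u t) *
      Complex.exp (insideSeries u t + dominatedSeries u t) = Complex.exp (insideSeries u t) := by
    rw [← Complex.exp_add]; congr 1; ring
  have h3 : Complex.exp (-dominatedSeries u t) * Complex.exp (dominatedSeries u t) = 1 := by
    rw [← Complex.exp_add]; simp
  calc _ = u * t * (Complex.exp (-dominatedSeries u t) * Complex.exp (outsideSeries u t)) +
        (t * (Complex.exp (-dominatedSeries u t) *
          Complex.exp (insideSeries u t + dominatedSeries u t)) -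
        t * (Complex.exp (-dominatedSeries u t) * Complex.exp (dominatedSeries u t))) := by
        simp only [sizeSeries, markWeight]; ring
    _ = _ := by
        rw [h1, h2, h3, mul_one, ← outsideSeries, ← dominatedSeries, ← insideSeries]

lemma markWeight_of_spawns {κ κ' : Mark} (h : κ.Spawns κ') [Decidable (κ = .inside)] :
    markWeight u t κ =
      (if κ = .inside then u else 1) * Complex.exp (sizeSeries u t * markWeight u t κ') := by
  have h1 : Complex.exp (-dominatedSeries u t) *
      Complex.exp (insideSeries u t + dominatedSeries u t) = Complex.exp (insideSeries u t) := by
    rw [← Complex.exp_add]; congr 1; ring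
  have h2 : Complex.exp (-dominatedSeries u t) * Complex.exp (dominatedSeries u t) = 1 := by
    rw [← Complex.exp_add]; simp
  cases h with
  | inside => simp [markWeight, sizeSeries, mul_assoc, h1, outsideSeries]
  | outside => rw [sizeSeries_mul_either]; simp [markWeight]
  | undominated =>
    simp [markWeight, sizeSeries, mul_assoc, mul_sub, h1, h2]
    rw [← outsideSeries, ← dominatedSeries]

lemma hasDerivAt_insideSeries :
    HasDerivAt (insideSeries u) (u * Complex.exp t * (1 + t)) t := by
  have := ((hasDerivAt_id t).const_mul u).mul (Complex.hasDerivAt_exp t)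
  convert! this using 1
  simp; ring

lemma hasDerivAt_outsideSeries : HasDerivAt (outsideSeries u)
    (Complex.exp (insideSeries u t) * (1 + insideSeries u t * (1 + t))) t := by
  have := (hasDerivAt_id t).mul (hasDerivAt_insideSeries u t).cexp
  convert! this using 1
  simp [insideSeries]; ring

lemma hasDerivAt_dominatedSeries : HasDerivAt (dominatedSeries u)
    (Complex.exp (insideSeries u t) * (1 + insideSeries u t * (1 + t)) - 1) t :=
  (hasDerivAt_outsideSeries u t).sub (hasDerivAt_id t)

lemma mul_deriv_insideSeries :
    t * deriv (insideSeries u) t = insideSeries u t * (1 + t) := by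
  rw [(hasDerivAt_insideSeries u t).deriv, insideSeries]; ring

lemma mul_deriv_dominatedSeries : t * deriv (dominatedSeries u) t = eulerDominated u t := by
  rw [(hasDerivAt_dominatedSeries u t).deriv, eulerDominated, outsideSeries]; ring

lemma mul_deriv_outsideSeries :
    t * deriv (outsideSeries u) t = eulerDominated u t + t := by
  rw [(hasDerivAt_outsideSeries u t).deriv, eulerDominated, outsideSeries]; ring

@[fun_prop] lemma differentiable_insideSeries : Differentiable ℂ (insideSeries u) :=
  fun t ↦ (hasDerivAt_insideSeries u t).differentiableAt

@[fun_prop] lemma differentiable_outsideSeries : Differentiable ℂ (outsideSeries u) :=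
  fun t ↦ (hasDerivAt_outsideSeries u t).differentiableAt

@[fun_prop] lemma differentiable_dominatedSeries : Differentiable ℂ (dominatedSeries u) :=
  fun t ↦ (hasDerivAt_dominatedSeries u t).differentiableAt

@[fun_prop] lemma differentiable_eulerDominated : Differentiable ℂ (eulerDominated u) := by
  unfold eulerDominated; fun_prop

@[fun_prop] lemma differentiable_treeSeries : Differentiable ℂ (treeSeries u) := by
  unfold treeSeries; fun_prop

@[fun_prop] lemma differentiable_sizeSeries : Differentiable ℂ (sizeSeries u) := by
  unfold sizeSeries; fun_prop

@[fun_prop] lemma differentiable_markWeight (κ : Mark) :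
    Differentiable ℂ fun t ↦ markWeight u t κ := by
  cases κ <;> unfold markWeight <;> fun_prop

lemma mul_deriv_treeSeries : t * deriv (treeSeries u) t =
    (insideSeries u t + dominatedSeries u t) * (1 - eulerDominated u t) := by
  have hA := (differentiable_insideSeries u t).hasDerivAt
  have hD := (differentiable_outsideSeries u t).hasDerivAt
  have hB := (differentiable_dominatedSeries u t).hasDerivAt
  have h := (((hA.add hB).sub (hA.mul hD)).sub ((hB.pow 2).div_const 2)).deriv
  have h' : deriv (treeSeries u) t = _ := h
  rw [h']
  have h1 := mul_deriv_insideSeries u t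
  have h2 := mul_deriv_outsideSeries u t
  have h3 := mul_deriv_dominatedSeries u t
  have h4 : eulerDominated u t = outsideSeries u t * (1 + insideSeries u t * (1 + t)) - t := rfl
  have h5 : dominatedSeries u t = outsideSeries u t - t := rfl
  push_cast
  rw [h5] at *
  linear_combination (1 - outsideSeries u t) * h1 - insideSeries u t * h2 +
    (1 - (outsideSeries u t - t)) * h3 + h4

end series

/-- The coefficient of order `m` of `H`, expanded as a power series in `sizeSeries u`; it is given
by an integral over the circle of radius `‖τ‖`. -/
noncomputable def lagrangeCoeff (u τ : ℂ) (m : ℕ) (H : ℂ → ℂ) : ℂ :=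
  Real.circleAverage (fun z ↦ H (τ * z) * (1 - eulerDominated u (τ * z)) *
    Complex.exp (m * dominatedSeries u (τ * z)) / (τ * z) ^ m) 0 1

section lagrangeCoeff

open Complex Metric

variable {u τ : ℂ} {m : ℕ} {H : ℂ → ℂ}

lemma circleIntegrable_div_pow (hτ : τ ≠ 0) {f : ℂ → ℂ} (hf : Differentiable ℂ f) (m : ℕ) :
    CircleIntegrable (fun z ↦ f (τ * z) / (τ * z) ^ m) 0 1 := by
  refine ContinuousOn.circleIntegrable' ?_
  refine ContinuousOn.div (hf.continuous.comp (by fun_prop)).continuousOn (by fun_prop) ?_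
  intro z hz
  have : z ≠ 0 := by rintro rfl; simp at hz
  positivity

lemma circleAverage_of_differentiable {f : ℂ → ℂ} (hf : Differentiable ℂ f) :
    Real.circleAverage (fun z ↦ f (τ * z)) 0 1 = f 0 := by
  have : Differentiable ℂ fun z ↦ f (τ * z) := by fun_prop
  simpa using this.diffContOnCl.circleAverage (c := 0) (R := 1)

lemma circleAverage_mul_deriv_eq_zero (hτ : τ ≠ 0) {f f' : ℂ → ℂ}
    (hf : ∀ t ≠ 0, HasDerivAt f (f' t) t) (hc : ContinuousOn f' {0}ᶜ) :
    Real.circleAverage (fun z ↦ τ * z * f' (τ * z)) 0 1 = 0 := by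
  have hne : ∀ θ : ℝ, τ * circleMap 0 1 θ ≠ 0 := fun θ ↦ mul_ne_zero hτ (by simp)
  have hd : ∀ θ : ℝ, HasDerivAt (fun θ : ℝ ↦ f (τ * circleMap 0 1 θ) / I)
      (τ * circleMap 0 1 θ * f' (τ * circleMap 0 1 θ)) θ := by
    intro θ
    have := ((hf _ (hne θ)).comp θ ((hasDerivAt_circleMap 0 1 θ).const_mul τ)).div_const I
    convert! this using 1
    field_simp
  rw [Real.circleAverage_def, intervalIntegral.integral_eq_sub_of_hasDerivAt (fun θ _ ↦ hd θ)]
  · simp [circleMap]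
  · refine Continuous.intervalIntegrable ?_ _ _
    have h2 : Continuous fun θ ↦ f' (τ * circleMap 0 1 θ) :=
      hc.comp_continuous (by fun_prop) fun θ ↦ hne θ
    exact (by fun_prop : Continuous fun θ ↦ τ * circleMap 0 1 θ).mul h2

lemma lagrangeCoeff_add (hτ : τ ≠ 0) {H₁ H₂ : ℂ → ℂ} (h₁ : Differentiable ℂ H₁)
    (h₂ : Differentiable ℂ H₂) :
    lagrangeCoeff u τ m (fun t ↦ H₁ t + H₂ t) =
      lagrangeCoeff u τ m H₁ + lagrangeCoeff u τ m H₂ := by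
  unfold lagrangeCoeff
  rw [← Real.circleAverage_fun_add]
  · simp only [add_mul, add_div]
  · exact circleIntegrable_div_pow hτ (f := fun t ↦ H₁ t * (1 - eulerDominated u t) *
      exp (m * dominatedSeries u t)) (by fun_prop) m
  · exact circleIntegrable_div_pow hτ (f := fun t ↦ H₂ t * (1 - eulerDominated u t) *
      exp (m * dominatedSeries u t)) (by fun_prop) m

lemma lagrangeCoeff_const_mul (c : ℂ) :
    lagrangeCoeff u τ m (fun t ↦ c * H t) = c * lagrangeCoeff u τ m H := by
  unfold lagrangeCoeff
  rw [← smul_eq_mul, ← Real.circleAverage_fun_smul]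
  simp only [smul_eq_mul, mul_assoc, mul_div_assoc]

lemma lagrangeCoeff_zero (hH : Differentiable ℂ H) : lagrangeCoeff u τ 0 H = H 0 := by
  have := circleAverage_of_differentiable (τ := τ) (f := fun t ↦ H t * (1 - eulerDominated u t))
    (by fun_prop)
  simpa [lagrangeCoeff, eulerDominated, outsideSeries] using this

lemma lagrangeCoeff_sizeSeries_pow_mul (hτ : τ ≠ 0) (s : ℕ) :
    lagrangeCoeff u τ (m + s) (fun t ↦ sizeSeries u t ^ s * H t) = lagrangeCoeff u τ m H := by
  refine Real.circleAverage_congr_sphere fun z hz ↦ ?_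
  have hz0 : τ * z ≠ 0 := mul_ne_zero hτ (by rintro rfl; simp at hz)
  have h : exp ((m + s : ℕ) * dominatedSeries u (τ * z)) * exp (-dominatedSeries u (τ * z)) ^ s =
      exp (m * dominatedSeries u (τ * z)) := by
    rw [← exp_nat_mul, ← exp_add]
    push_cast
    congr 1
    ring
  simp only [← h, sizeSeries, mul_pow _ (exp _)]
  generalize τ * z = t at *
  field_simp
  ring

lemma lagrangeCoeff_sizeSeries_pow_mul_of_lt (hτ : τ ≠ 0) (hH : Differentiable ℂ H) {s : ℕ}
    (hs : m < s) : lagrangeCoeff u τ m (fun t ↦ sizeSeries u t ^ s * H t) = 0 := by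
  obtain ⟨k, rfl⟩ := Nat.exists_eq_add_of_lt hs
  have := circleAverage_of_differentiable (τ := τ)
    (f := fun t ↦ t ^ (k + 1) * (exp (-dominatedSeries u t) ^ (m + k + 1) * H t *
      (1 - eulerDominated u t) * exp (m * dominatedSeries u t))) (by fun_prop)
  simp only [ne_eq, Nat.add_eq_zero_iff, one_ne_zero, and_false, not_false_eq_true, zero_pow,
    zero_mul] at this
  rw [← this]
  refine Real.circleAverage_congr_sphere fun z hz ↦ ?_
  have hz0 : τ * z ≠ 0 := mul_ne_zero hτ (by rintro rfl; simp at hz)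
  simp only [sizeSeries, mul_pow _ (exp _)]
  field_simp
  ring

lemma lagrangeCoeff_exp_mul (hτ : τ ≠ 0) {g : ℂ → ℂ} (hg : Differentiable ℂ g)
    (hH : Differentiable ℂ H) :
    lagrangeCoeff u τ m (fun t ↦ exp (sizeSeries u t * g t) * H t) =
      ∑ s ∈ Finset.range (m + 1),
        (s.factorial : ℂ)⁻¹ * lagrangeCoeff u τ (m - s) (fun t ↦ g t ^ s * H t) := by
  have key : HasSum (fun s : ℕ ↦ lagrangeCoeff u τ m
      (fun t ↦ (s.factorial : ℂ)⁻¹ * (sizeSeries u t ^ s * (g t ^ s * H t))))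
      (lagrangeCoeff u τ m (fun t ↦ exp (sizeSeries u t * g t) * H t)) := by
    have hne : ∀ θ : ℝ, τ * circleMap 0 1 θ ≠ 0 := fun θ ↦ mul_ne_zero hτ (by simp)
    set K : ℝ → ℂ := fun θ ↦ H (τ * circleMap 0 1 θ) *
      (1 - eulerDominated u (τ * circleMap 0 1 θ)) *
      exp (m * dominatedSeries u (τ * circleMap 0 1 θ)) / (τ * circleMap 0 1 θ) ^ m with hK
    set Y : ℝ → ℂ := fun θ ↦ sizeSeries u (τ * circleMap 0 1 θ) * g (τ * circleMap 0 1 θ) with hY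
    have c1 : Continuous (dominatedSeries u) := (differentiable_dominatedSeries u).continuous
    have c2 : Continuous (eulerDominated u) := (differentiable_eulerDominated u).continuous
    have c3 : Continuous (sizeSeries u) := (differentiable_sizeSeries u).continuous
    have c4 := hg.continuous
    have c5 := hH.continuous
    have hKc : Continuous K := by
      refine Continuous.div (by fun_prop) (by fun_prop) fun θ ↦ pow_ne_zero _ (hne θ)
    have hYc : Continuous Y := by fun_prop
    obtain ⟨k, hk⟩ := isCompact_uIcc.exists_bound_of_continuousOn
      (hKc.continuousOn (s := Set.uIcc 0 (2 * Real.pi)))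
    obtain ⟨y, hy⟩ := isCompact_uIcc.exists_bound_of_continuousOn
      (hYc.continuousOn (s := Set.uIcc 0 (2 * Real.pi)))
    have hsum : Summable fun s : ℕ ↦ (s.factorial : ℝ)⁻¹ * y ^ s * k := by
      refine Summable.mul_right _ ?_
      simpa [div_eq_inv_mul] using Real.summable_pow_div_factorial y
    have := intervalIntegral.hasSum_integral_of_dominated_convergence (μ := MeasureTheory.volume)
      (a := 0) (b := 2 * Real.pi) (F := fun (s : ℕ) θ ↦ (s.factorial : ℂ)⁻¹ * Y θ ^ s * K θ)
      (f := fun θ ↦ exp (Y θ) * K θ) (fun s _ ↦ (s.factorial : ℝ)⁻¹ * y ^ s * k)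
      (fun s ↦ by fun_prop)
      (fun s ↦ .of_forall fun θ hθ ↦ ?_) (.of_forall fun θ _ ↦ hsum)
      intervalIntegrable_const (.of_forall fun θ _ ↦ ?_)
    · convert! this.const_smul ((2 * Real.pi)⁻¹ : ℝ) using 1
      · ext s
        simp only [lagrangeCoeff, Real.circleAverage_def, hK, hY]
        congr 2
        ext θ
        ring
      · simp only [lagrangeCoeff, Real.circleAverage_def, hK, hY]
        congr 2
        ext θ
        ring
    · have hθ' := Set.uIoc_subset_uIcc hθ
      rw [norm_mul, norm_mul, norm_pow, norm_inv, Complex.norm_natCast]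
      have hk0 := (norm_nonneg _).trans (hk θ hθ')
      have hy0 := (norm_nonneg _).trans (hy θ hθ')
      exact mul_le_mul (mul_le_mul_of_nonneg_left (pow_le_pow_left₀ (norm_nonneg _) (hy θ hθ') s)
        (by positivity)) (hk θ hθ') (norm_nonneg _) (by positivity)
    · refine HasSum.mul_right _ ?_
      rw [Complex.exp_eq_exp_ℂ]
      simpa [div_eq_inv_mul] using NormedSpace.expSeries_div_hasSum_exp (Y θ)
  rw [← key.tsum_eq, tsum_eq_sum (s := Finset.range (m + 1))]
  · refine Finset.sum_congr rfl fun s hs ↦ ?_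
    have hs' : m - s + s = m := Nat.sub_add_cancel (by simpa [Nat.lt_succ_iff] using hs)
    rw [lagrangeCoeff_const_mul]
    conv_lhs => rw [← hs']
    rw [lagrangeCoeff_sizeSeries_pow_mul hτ]
  · intro s hs
    rw [lagrangeCoeff_const_mul, lagrangeCoeff_sizeSeries_pow_mul_of_lt hτ (by fun_prop)
      (by simpa using hs), mul_zero]

lemma mul_lagrangeCoeff (hτ : τ ≠ 0) (hH : Differentiable ℂ H) :
    m * lagrangeCoeff u τ m H = Real.circleAverage (fun z ↦ τ * z * deriv H (τ * z) *
      exp (m * dominatedSeries u (τ * z)) / (τ * z) ^ m) 0 1 := by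
  have hd : ∀ t ≠ 0, HasDerivAt (fun t ↦ H t * exp (m * dominatedSeries u t) / t ^ m)
      (deriv H t * exp (m * dominatedSeries u t) / t ^ m -
        m * (H t * (1 - eulerDominated u t) * exp (m * dominatedSeries u t) / t ^ m) / t) t := by
    intro t ht
    have hB := (differentiable_dominatedSeries u t).hasDerivAt
    have := ((hH t).hasDerivAt.mul (hB.const_mul (m : ℂ)).cexp).div (hasDerivAt_pow m t)
      (pow_ne_zero m ht)
    convert! this using 1
    have h := mul_deriv_dominatedSeries u t
    rw [← h]
    rcases m with _ | m
    · simp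
    · simp only [Nat.add_sub_cancel, Pi.mul_apply]
      field_simp
      ring
  have hH' : Differentiable ℂ (deriv H) := hH.deriv
  have hc : ContinuousOn (fun t ↦ deriv H t * exp (m * dominatedSeries u t) / t ^ m -
        m * (H t * (1 - eulerDominated u t) * exp (m * dominatedSeries u t) / t ^ m) / t)
        {0}ᶜ := by
    have c1 : Continuous (dominatedSeries u) := (differentiable_dominatedSeries u).continuous
    have c2 : Continuous (eulerDominated u) := (differentiable_eulerDominated u).continuous
    have c3 := hH.continuous
    have c4 := hH'.continuous
    fun_prop (disch := simp_all)
  have h0 := circleAverage_mul_deriv_eq_zero hτ hd hc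
  have h1 : Real.circleAverage (fun z ↦ τ * z * (deriv H (τ * z) *
      exp (m * dominatedSeries u (τ * z)) / (τ * z) ^ m -
        m * (H (τ * z) * (1 - eulerDominated u (τ * z)) *
          exp (m * dominatedSeries u (τ * z)) / (τ * z) ^ m) / (τ * z))) 0 1 =
      Real.circleAverage (fun z ↦ τ * z * deriv H (τ * z) *
        exp (m * dominatedSeries u (τ * z)) / (τ * z) ^ m -
        (m : ℂ) • (H (τ * z) * (1 - eulerDominated u (τ * z)) *
          exp (m * dominatedSeries u (τ * z)) / (τ * z) ^ m)) 0 1 := by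
    refine Real.circleAverage_congr_sphere fun z hz ↦ ?_
    have hz0 : z ≠ 0 := by rintro rfl; simp at hz
    simp only [smul_eq_mul]
    field_simp
  have i1 := circleIntegrable_div_pow hτ (f := fun t ↦ t * deriv H t *
    exp (m * dominatedSeries u t)) (by fun_prop) m
  have i2 := circleIntegrable_div_pow hτ (f := fun t ↦ H t * (1 - eulerDominated u t) *
    exp (m * dominatedSeries u t)) (by fun_prop) m
  rw [h1, Real.circleAverage_fun_sub i1 i2.const_fun_smul, Real.circleAverage_fun_smul, sub_eq_zero]
    at h0
  exact h0.symm

end lagrangeCoeff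

section markedFormula

open Complex Finset

variable {V W : Type*} [Fintype V] [Fintype W]

open scoped Classical in
/-- The value of `markedCount u c` predicted by Lagrange inversion. -/
noncomputable def markedFormula (u τ : ℂ) (c : V → Mark) : ℂ :=
  (#{v | c v = .free}).factorial * lagrangeCoeff u τ #{v | c v = .free}
    fun t ↦ (∏ v, markWeight u t (c v)) * exp (treeSeries u t)

variable {u τ : ℂ}

lemma markedFormula_comp_equiv (e : V ≃ W) (c : W → Mark) :
    markedFormula u τ (c ∘ e) = markedFormula u τ c := by
  classical
  have h1 : #{v | (c ∘ e) v = .free} = #{w | c w = .free} :=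
    card_bij (fun v _ ↦ e v) (by simp) (by simp) fun w hw ↦ ⟨e.symm w, by simpa using hw, by simp⟩
  have h2 (t : ℂ) : ∏ v, markWeight u t ((c ∘ e) v) = ∏ w, markWeight u t (c w) :=
    e.prod_comp fun w ↦ markWeight u t (c w)
  simp only [markedFormula, h1, h2]

lemma markedCount_option_eq (hτ : τ ≠ 0)
    (h : ∀ c : V → Mark, markedCount u c = markedFormula u τ c) {c : Option V → Mark} {κ : Mark}
    (hκ : (c none).Spawns κ) : markedCount u c = markedFormula u τ c := by
  classical
  set F : Finset V := {v | c (some v) = .free} with hF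
  set G : ℂ → ℂ := fun t ↦ (∏ v, markWeight u t (c (some v))) * exp (treeSeries u t) with hG
  have hGd : Differentiable ℂ G := by fun_prop
  have hκf : κ ≠ .free := by
    generalize c none = κ' at hκ
    cases hκ <;> simp
  have hcf : c none ≠ .free := by
    generalize c none = κ' at hκ
    cases hκ <;> simp
  have hcard : #{v | c v = .free} = #F := by
    symm
    refine card_bij (fun v _ ↦ some v) (by simp [hF]) (by simp) fun v hv ↦ ?_
    rcases v with _ | v
    · simp [hcf] at hv
    · exact ⟨v, by simpa [hF] using hv, rfl⟩
  have hN : ∀ N ∈ F.powerset, markedCount u (fun v ↦ if v ∈ N then κ else c (some v)) =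
      (#F - #N).factorial * lagrangeCoeff u τ (#F - #N)
        fun t ↦ markWeight u t κ ^ #N * G t := by
    intro N hN
    rw [mem_powerset] at hN
    have h1 : #{v | (if v ∈ N then κ else c (some v)) = .free} = #F - #N := by
      rw [← card_sdiff_of_subset hN]
      congr 1
      ext v
      by_cases hv : v ∈ N <;> simp [hv, hF, hκf]
    have h2 (t : ℂ) : ∏ v, markWeight u t (if v ∈ N then κ else c (some v)) =
        markWeight u t κ ^ #N * ∏ v, markWeight u t (c (some v)) := by
      have : ∀ v, markWeight u t (if v ∈ N then κ else c (some v)) =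
          (if v ∈ N then markWeight u t κ else 1) * markWeight u t (c (some v)) := by
        intro v
        by_cases hv : v ∈ N
        · have : c (some v) = .free := by simpa [hF] using hN hv
          simp [hv, this, markWeight]
        · simp [hv]
      simp only [this, prod_mul_distrib]
      congr 1
      simp
    simp only [h, markedFormula, h1, h2, hG, mul_assoc]
  have hprod (t : ℂ) : (∏ v, markWeight u t (c v)) * exp (treeSeries u t) =
      (if c none = .inside then u else 1) * (exp (sizeSeries u t * markWeight u t κ) * G t) := by
    rw [Fintype.prod_option, markWeight_of_spawns u t hκ]
    simp only [hG, mul_assoc]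
  rw [markedCount_option hκ, sum_congr rfl hN, markedFormula]
  simp only [hcard, hprod]
  rw [lagrangeCoeff_const_mul, lagrangeCoeff_exp_mul hτ (by fun_prop) hGd,
    sum_powerset_apply_card (fun s ↦ ((#F - s).factorial : ℂ) * lagrangeCoeff u τ (#F - s)
      fun t ↦ markWeight u t κ ^ s * G t), mul_left_comm]
  congr 1
  rw [mul_sum]
  refine sum_congr rfl fun s hs ↦ ?_
  have hs' : s ≤ #F := by simpa [Nat.lt_succ_iff] using hs
  have hfac : ((#F).choose s : ℂ) * s.factorial * (#F - s).factorial = (#F).factorial := by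
    exact_mod_cast Nat.choose_mul_factorial_mul_factorial hs'
  have hs0 : (s.factorial : ℂ) ≠ 0 := by exact_mod_cast s.factorial_ne_zero
  rw [nsmul_eq_mul, ← hfac]
  field_simp

lemma markedFormula_eq_add (hτ : τ ≠ 0) {c : V → Mark} {r : V} {κ₁ κ₂ : Mark} [DecidableEq V]
    (hr : c r = .outside ∧ κ₁ = .dominated ∧ κ₂ = .undominated ∨
      c r = .either ∧ κ₁ = .inside ∧ κ₂ = .dominated) :
    markedFormula u τ c = markedFormula u τ (Function.update c r κ₁) +
      markedFormula u τ (Function.update c r κ₂) := by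
  classical
  have hw (t : ℂ) : markWeight u t (c r) = markWeight u t κ₁ + markWeight u t κ₂ := by
    rcases hr with ⟨h, rfl, rfl⟩ | ⟨h, rfl, rfl⟩ <;> simp [h, markWeight]
  have hcard (κ : Mark) (hκ : κ ≠ .free) :
      #{v | Function.update c r κ v = .free} = #{v | c v = .free} := by
    congr 1
    ext v
    rcases eq_or_ne v r with rfl | hv
    · rcases hr with ⟨h, -⟩ | ⟨h, -⟩ <;> simp [hκ, h]
    · simp [hv]
  have hprod (t : ℂ) (κ : Mark) : ∏ v, markWeight u t (Function.update c r κ v) =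
      markWeight u t κ * ∏ v ∈ univ.erase r, markWeight u t (c v) := by
    rw [← mul_prod_erase univ _ (mem_univ r)]
    congr 1
    · simp
    · refine prod_congr rfl fun v hv ↦ ?_
      simp [ne_of_mem_erase hv]
  have hprod' (t : ℂ) : ∏ v, markWeight u t (c v) =
      (∏ v, markWeight u t (Function.update c r κ₁ v)) +
        ∏ v, markWeight u t (Function.update c r κ₂ v) := by
    rw [hprod, hprod, ← add_mul, ← hw,
      mul_prod_erase univ (fun v ↦ markWeight u t (c v)) (mem_univ r)]
  have h1 : κ₁ ≠ .free := by rcases hr with ⟨h, rfl, rfl⟩ | ⟨h, rfl, rfl⟩ <;> simp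
  have h2 : κ₂ ≠ .free := by rcases hr with ⟨h, rfl, rfl⟩ | ⟨h, rfl, rfl⟩ <;> simp
  simp only [markedFormula, hcard _ h1, hcard _ h2, hprod', add_mul]
  rw [lagrangeCoeff_add hτ (by fun_prop) (by fun_prop), mul_add]

lemma markedCount_eq_of_spawns [DecidableEq V] (hτ : τ ≠ 0) {r : V}
    (h : ∀ c : {v // v ≠ r} → Mark, markedCount u c = markedFormula u τ c)
    {c : V → Mark} {κ : Mark} (hκ : (c r).Spawns κ) :
    markedCount u c = markedFormula u τ c := by
  have e := markedCount_comp_equiv (Equiv.optionSubtypeNe r) u c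
  rw [← e, ← markedFormula_comp_equiv (Equiv.optionSubtypeNe r) c]
  exact markedCount_option_eq hτ h (κ := κ) (by simpa using hκ)

lemma markedCount_eq_of_ne_free [DecidableEq V] (hτ : τ ≠ 0) {r : V}
    (h : ∀ c : {v // v ≠ r} → Mark, markedCount u c = markedFormula u τ c)
    {c : V → Mark} (hc : c r ≠ .free) : markedCount u c = markedFormula u τ c := by
  classical
  have hdom : ∀ c : V → Mark, c r = .dominated → markedCount u c = markedFormula u τ c := by
    intro c hc
    have hr : Function.update c r .outside r = .outside := by simp
    have h1 := markedCount_eq_add (.inl ⟨hr, rfl, rfl⟩) u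
    have h2 := markedFormula_eq_add (u := u) hτ (.inl ⟨hr, rfl, rfl⟩)
    rw [Function.update_idem, Function.update_idem, ← hc, Function.update_eq_self] at h1 h2
    rw [markedCount_eq_of_spawns hτ h (κ := .either) (by rw [hr]; exact .outside), h2,
      markedCount_eq_of_spawns (c := Function.update c r .undominated) hτ h (κ := .dominated)
        (by simpa using .undominated)] at h1
    exact (add_right_cancel h1).symm
  match hcr : c r with
  | .free => exact absurd hcr hc
  | .inside => exact markedCount_eq_of_spawns hτ h (κ := .outside) (hcr ▸ .inside)
  | .outside => exact markedCount_eq_of_spawns hτ h (κ := .either) (hcr ▸ .outside)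
  | .undominated => exact markedCount_eq_of_spawns hτ h (κ := .dominated) (hcr ▸ .undominated)
  | .dominated => exact hdom c hcr
  | .either =>
    rw [markedCount_eq_add (.inr ⟨hcr, rfl, rfl⟩), markedFormula_eq_add hτ (.inr ⟨hcr, rfl, rfl⟩),
      hdom (Function.update c r .dominated) (by simp),
      markedCount_eq_of_spawns (c := Function.update c r .inside) hτ h (κ := .outside)
        (by simpa using .inside)]

lemma succ_mul_lagrangeCoeff_exp_treeSeries (hτ : τ ≠ 0) (n : ℕ) :
    (n + 1 : ℕ) * lagrangeCoeff u τ (n + 1) (fun t ↦ exp (treeSeries u t)) =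
      lagrangeCoeff u τ n fun t ↦ markWeight u t .either * exp (treeSeries u t) := by
  rw [mul_lagrangeCoeff hτ (by fun_prop), ← lagrangeCoeff_sizeSeries_pow_mul hτ 1, lagrangeCoeff]
  congr 1
  ext z
  have hd : deriv (fun t ↦ exp (treeSeries u t)) (τ * z) =
      exp (treeSeries u (τ * z)) * deriv (treeSeries u) (τ * z) :=
    (differentiable_treeSeries u _).hasDerivAt.cexp.deriv
  rw [hd, pow_one, ← mul_assoc (sizeSeries u _), sizeSeries_mul_either]
  congr 2
  linear_combination exp (treeSeries u (τ * z)) * mul_deriv_treeSeries u (τ * z)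

lemma markedCount_eq_of_forall_free [DecidableEq V] (hτ : τ ≠ 0) {r : V}
    (h : ∀ c : {v // v ≠ r} → Mark, markedCount u c = markedFormula u τ c)
    {c : V → Mark} (hc : ∀ v, c v = .free) : markedCount u c = markedFormula u τ c := by
  classical
  rw [markedCount_free hc r, markedCount_eq_of_ne_free (r := r) hτ h (by simp)]
  obtain ⟨n, hn⟩ : ∃ n, Fintype.card V = n + 1 :=
    have : Nonempty V := ⟨r⟩
    Nat.exists_eq_succ_of_ne_zero Fintype.card_ne_zero
  have h1 : #{v | c v = .free} = n + 1 := by simp [hc, hn]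
  have h2 : #{v | Function.update c r .either v = .free} = n := by
    have : ({v | Function.update c r .either v = .free} : Finset V) = univ.erase r := by
      ext v
      rcases eq_or_ne v r with rfl | hv <;> simp [*]
    rw [this, card_erase_of_mem (mem_univ r), card_univ, hn, Nat.add_sub_cancel]
  have h3 (t : ℂ) : ∏ v, markWeight u t (c v) = 1 :=
    prod_eq_one fun v _ ↦ by rw [hc v, markWeight]
  have h4 (t : ℂ) : ∏ v, markWeight u t (Function.update c r .either v) =
      markWeight u t .either := by
    rw [prod_eq_single r]
    · simp
    · intro v _ hv; simp [hv, hc v, markWeight]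
    · simp
  simp only [markedFormula, h1, h2, h3, h4, one_mul]
  rw [← succ_mul_lagrangeCoeff_exp_treeSeries hτ, Nat.factorial_succ]
  push_cast
  ring

end markedFormula

section enumeration

open Complex

universe v

variable {V : Type v} [Fintype V] {u τ : ℂ}

theorem markedCount_eq (hτ : τ ≠ 0) (c : V → Mark) :
    markedCount u c = markedFormula u τ c := by
  classical
  induction hn : Fintype.card V generalizing V with
  | zero =>
    have := Fintype.card_eq_zero_iff.1 hn
    rw [markedCount_of_isEmpty]
    simp only [markedFormula, Finset.univ_eq_empty, Finset.filter_empty, Finset.card_empty,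
      Finset.prod_empty]
    rw [lagrangeCoeff_zero (by fun_prop)]
    simp [treeSeries, insideSeries, dominatedSeries, outsideSeries]
  | succ n ih =>
    have h (r : V) (c : {v // v ≠ r} → Mark) : markedCount u c = markedFormula u τ c :=
      ih c (by simp [Fintype.card_subtype_compl, hn])
    by_cases! hc : ∀ v, c v = .free
    · have : Nonempty V := Fintype.card_pos_iff.1 (by omega)
      exact markedCount_eq_of_forall_free hτ (h (Classical.arbitrary V)) hc
    · obtain ⟨r, hr⟩ := hc
      exact markedCount_eq_of_ne_free hτ (h r) hr

end enumeration

/-- The generating polynomial, in the number of vertices of the maximal independent set, of the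
forests on `Fin n` with a maximal independent set. -/
noncomputable def sizePolynomial (n : ℕ) (u : ℂ) : ℂ := markedCount u fun _ : Fin n ↦ Mark.free

/-- The function whose contour integrals give the coefficients of `sizePolynomial`. -/
noncomputable def saddleAmplitude (u t : ℂ) : ℂ :=
  t * deriv (fun t ↦ (insideSeries u t + dominatedSeries u t) * Complex.exp (treeSeries u t)) t

lemma sq_mul_sizePolynomial {u τ : ℂ} (hτ : τ ≠ 0) (n : ℕ) :
    (n : ℂ) ^ 2 * sizePolynomial n u = n.factorial *
      Real.circleAverage (fun z ↦ saddleAmplitude u (τ * z) *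
        Complex.exp (n * dominatedSeries u (τ * z)) / (τ * z) ^ n) 0 1 := by
  have h1 : sizePolynomial n u =
      n.factorial * lagrangeCoeff u τ n fun t ↦ Complex.exp (treeSeries u t) := by
    rw [sizePolynomial, markedCount_eq hτ, markedFormula]
    simp [markWeight]
  have h2 : n * lagrangeCoeff u τ n (fun t ↦ Complex.exp (treeSeries u t)) =
      lagrangeCoeff u τ n fun t ↦
        (insideSeries u t + dominatedSeries u t) * Complex.exp (treeSeries u t) := by
    rw [mul_lagrangeCoeff hτ (by fun_prop), lagrangeCoeff]
    congr 1
    ext z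
    have hd : deriv (fun t ↦ Complex.exp (treeSeries u t)) (τ * z) =
        Complex.exp (treeSeries u (τ * z)) * deriv (treeSeries u) (τ * z) :=
      (differentiable_treeSeries u _).hasDerivAt.cexp.deriv
    rw [hd]
    congr 2
    linear_combination Complex.exp (treeSeries u (τ * z)) * mul_deriv_treeSeries u (τ * z)
  have h3 := mul_lagrangeCoeff (u := u) (m := n) hτ (H := fun t ↦
    (insideSeries u t + dominatedSeries u t) * Complex.exp (treeSeries u t)) (by fun_prop)
  simp only [saddleAmplitude]
  rw [← h3, ← h2, h1]
  ring

section MISpace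

open Finset

instance (n : ℕ) : Finite (MISpace n) := inferInstanceAs (Finite (Subtype _))

lemma isMarkedForest_free_iff {V : Type*} {G : SimpleGraph V} {J : Set V} :
    IsMarkedForest (fun _ ↦ Mark.free) G J ↔ G.IsAcyclic ∧ IsMaximalIndepSet G J := by
  refine ⟨fun ⟨h1, _, h3⟩ ↦ ⟨h1, fun v w hv hw hvw ↦ ?_, fun J' hJ' hJ ↦ ?_⟩,
    fun ⟨h1, h2, h3⟩ ↦ ⟨h1, fun v hv ↦ absurd rfl hv,
      fun v ↦ ⟨fun hv ⟨w, hw, hvw⟩ ↦ ?_, fun hv ↦ ?_⟩⟩⟩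
  · exact (h3 v).1 hv ⟨w, hw, hvw⟩
  · obtain ⟨v, hv', hv⟩ := Set.exists_of_ssubset hJ
    exact hv ((h3 v).2 fun ⟨w, hw, hvw⟩ ↦ hJ' hv' (hJ.1 hw) hvw)
  · exact h2 hv hw hvw
  · by_contra hvJ
    refine h3 (insert v J) ?_ (Set.ssubset_insert hvJ)
    rintro a b (rfl | ha) (rfl | hb) hab
    · exact hab.ne rfl
    · exact hv ⟨b, hb, hab⟩
    · exact hv ⟨a, ha, hab.symm⟩
    · exact h2 ha hb hab

lemma sizePolynomial_eq_sum (n : ℕ) [Fintype (MISpace n)] (u : ℂ) :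
    sizePolynomial n u = ∑ p : MISpace n, u ^ p.val.2.ncard := by
  classical
  rw [sizePolynomial, markedCount]
  simp only [isMarkedForest_free_iff]
  have h := sum_subtype (p := fun p : SimpleGraph (Fin n) × Set (Fin n) ↦
    p.1.IsAcyclic ∧ IsMaximalIndepSet p.1 p.2) (F := ‹Fintype (MISpace n)›)
    (univ.filter fun p ↦ p.1.IsAcyclic ∧ IsMaximalIndepSet p.1 p.2) (by simp)
    fun p : SimpleGraph (Fin n) × Set (Fin n) ↦ u ^ p.2.ncard
  refine Eq.trans ?_ h
  have key (J : Set (Fin n)) : ∏ v, (if v ∈ J then u else 1) = u ^ J.ncard := by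
    rw [prod_ite, prod_const, prod_const_one, mul_one, Set.ncard_eq_toFinset_card']
    congr 2
    ext
    simp
  simp only [key]
  congr!

lemma differentiable_sizePolynomial (n : ℕ) : Differentiable ℂ (sizePolynomial n) := by
  have := Fintype.ofFinite (MISpace n)
  rw [funext (sizePolynomial_eq_sum n)]
  fun_prop

lemma hasDerivAt_mul_logDeriv_sizePolynomial {n : ℕ} (h : sizePolynomial n 1 ≠ 0) :
    HasDerivAt (fun u ↦ u * logDeriv (sizePolynomial n) u) (Vn n : ℂ) 1 := by
  have := Fintype.ofFinite (MISpace n)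
  have hP (u : ℂ) : HasDerivAt (sizePolynomial n)
      (∑ p : MISpace n, (p.val.2.ncard : ℂ) * u ^ (p.val.2.ncard - 1)) u := by
    rw [funext (sizePolynomial_eq_sum n)]
    exact HasDerivAt.fun_sum fun p _ ↦ hasDerivAt_pow _ u
  have hM : HasDerivAt (fun u : ℂ ↦ ∑ p : MISpace n, (p.val.2.ncard : ℂ) * u ^ p.val.2.ncard)
      (∑ p : MISpace n, (p.val.2.ncard : ℂ) ^ 2) 1 := by
    refine HasDerivAt.fun_sum fun p _ ↦ ?_
    convert! (hasDerivAt_pow p.val.2.ncard (1 : ℂ)).const_mul (p.val.2.ncard : ℂ) using 1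
    simp [sq]
  have heq : (fun u ↦ u * logDeriv (sizePolynomial n) u) = fun u ↦
      (∑ p : MISpace n, (p.val.2.ncard : ℂ) * u ^ p.val.2.ncard) / sizePolynomial n u := by
    ext u
    rw [logDeriv_apply, (hP u).deriv, mul_div_assoc', mul_sum]
    congr 2
    ext p
    rcases p.val.2.ncard with _ | k
    · simp
    · rw [Nat.add_sub_cancel]; ring
  have h1 : sizePolynomial n 1 = iN n := by
    rw [sizePolynomial_eq_sum, iN, Nat.card_eq_fintype_card]
    simp
  rw [heq]
  convert! hM.div (hP 1) h using 1
  rw [h1] at h ⊢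
  rw [Vn, En, finsum_eq_sum_of_fintype, finsum_eq_sum_of_fintype]
  push_cast
  simp only [one_pow, mul_one]
  field_simp

end MISpace

section Laplace

variable {X : Type*} [TopologicalSpace X] [FirstCountableTopology X] {x₀ : X}

lemma sqrt_mul_integral_eq {n : ℕ} (hn : n ≠ 0) (q R : ℝ → ℂ) {b : ℝ} (hb : 0 ≤ b) :
    (√n : ℂ) * ∫ θ in (-b)..b, q θ * Complex.exp (n * θ ^ 2 * R θ) =
      ∫ s : ℝ,
        (Set.Ioc (-b) b).indicator (fun θ ↦ q θ * Complex.exp (s ^ 2 * R θ)) ((√n)⁻¹ * s) := by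
  have hn' : (0 : ℝ) < √n := by positivity
  have h := Measure.integral_comp_mul_left
    ((Set.Ioc (-b) b).indicator fun θ ↦ q θ * Complex.exp (n * θ ^ 2 * R θ)) (√n)⁻¹
  rw [inv_inv, abs_of_pos hn', integral_indicator measurableSet_Ioc,
    ← intervalIntegral.integral_of_le (by linarith), Complex.real_smul] at h
  rw [← h]
  congr 1
  ext s
  by_cases hs : (√n)⁻¹ * s ∈ Set.Ioc (-b) b
  · rw [Set.indicator_of_mem hs, Set.indicator_of_mem hs]
    have h2 : (n : ℂ) * ((√n : ℂ)⁻¹ * s) ^ 2 = s ^ 2 := by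
      have h3 : (√n : ℂ) ^ 2 = n := by
        rw [← Complex.ofReal_pow, Real.sq_sqrt n.cast_nonneg, Complex.ofReal_natCast]
      rw [mul_pow, inv_pow, h3, mul_inv_cancel_left₀ (by exact_mod_cast hn)]
    push_cast
    rw [h2]
  · rw [Set.indicator_of_notMem hs, Set.indicator_of_notMem hs]

/-- Laplace's method for a quadratic phase, locally uniformly in a parameter. -/
theorem tendsto_sqrt_mul_integral {q R : X → ℝ → ℂ} (hq : Continuous ↿q) (hR : Continuous ↿R)
    {b : ℝ} (hb : 0 < b) (hneg : ∀ θ ∈ Set.Icc (-b) b, (R x₀ θ).re < 0) :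
    Tendsto (fun p : ℕ × X ↦ (√p.1 : ℂ) * ∫ θ in (-b)..b,
      q p.2 θ * Complex.exp (p.1 * θ ^ 2 * R p.2 θ)) (atTop ×ˢ 𝓝 x₀)
      (𝓝 (∫ s : ℝ, q x₀ 0 * Complex.exp (s ^ 2 * R x₀ 0))) := by
  obtain ⟨k, hk0, hk⟩ : ∃ k > 0, ∀ θ ∈ Set.Icc (-b) b, (R x₀ θ).re < -k := by
    have hc : ContinuousOn (fun θ ↦ (R x₀ θ).re) (Set.Icc (-b) b) :=
      (Complex.continuous_re.comp (hR.comp (Continuous.prodMk_right x₀))).continuousOn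
    obtain ⟨θ₀, hθ₀, hmax⟩ := isCompact_Icc.exists_isMaxOn ⟨0, by simp [hb.le]⟩ hc
    refine ⟨-(R x₀ θ₀).re / 2, by linarith [hneg θ₀ hθ₀], fun θ hθ ↦ ?_⟩
    have h1 : (R x₀ θ).re ≤ (R x₀ θ₀).re := hmax hθ
    linarith [hneg θ₀ hθ₀]
  obtain ⟨M, hM⟩ := isCompact_Icc.exists_bound_of_continuousOn
    (hq.comp (Continuous.prodMk_right x₀)).continuousOn (s := Set.Icc (-b) b)
  have hRev : ∀ᶠ x in 𝓝 x₀, ∀ θ ∈ Set.Icc (-b) b, (R x θ).re < -k ∧ ‖q x θ‖ < M + 1 := by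
    refine isCompact_Icc.eventually_forall_of_forall_eventually fun θ hθ ↦ ?_
    refine (((Complex.continuous_re.comp hR).tendsto (x₀, θ)).eventually_lt_const (hk θ hθ)).and
      ((hq.norm.tendsto (x₀, θ)).eventually_lt_const ?_)
    exact (hM θ hθ).trans_lt (lt_add_one M)
  have hnev : ∀ᶠ n : ℕ in atTop, n ≠ 0 := eventually_ne_atTop 0
  have hdct : Tendsto (fun p : ℕ × X ↦ ∫ s : ℝ, (Set.Ioc (-b) b).indicator
      (fun θ ↦ q p.2 θ * Complex.exp (s ^ 2 * R p.2 θ)) ((√p.1)⁻¹ * s)) (atTop ×ˢ 𝓝 x₀)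
      (𝓝 (∫ s : ℝ, q x₀ 0 * Complex.exp (s ^ 2 * R x₀ 0))) := by
    refine tendsto_integral_filter_of_dominated_convergence
      (fun s ↦ (M + 1) * Real.exp (-k * s ^ 2)) (.of_forall fun p ↦ ?_) ?_
      ((integrable_exp_neg_mul_sq hk0).const_mul _) (.of_forall fun s ↦ ?_)
    · have h1 : Continuous (q p.2) := hq.comp (Continuous.prodMk_right _)
      have h2 : Continuous (R p.2) := hR.comp (Continuous.prodMk_right _)
      refine Measurable.aestronglyMeasurable ?_
      simp only [Set.indicator_apply]
      refine Measurable.ite (measurableSet_Ioc.preimage (by fun_prop)) ?_ measurable_const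
      exact (by fun_prop : Continuous fun s : ℝ ↦
        q p.2 ((√p.1)⁻¹ * s) * Complex.exp (s ^ 2 * R p.2 ((√p.1)⁻¹ * s))).measurable
    · filter_upwards [hRev.prod_inr atTop] with p hp
      refine .of_forall fun s ↦ ?_
      by_cases hs : (√p.1)⁻¹ * s ∈ Set.Ioc (-b) b
      · obtain ⟨h1, h2⟩ := hp _ (Set.Ioc_subset_Icc_self hs)
        rw [Set.indicator_of_mem hs, norm_mul, Complex.norm_exp]
        refine mul_le_mul h2.le (Real.exp_le_exp.2 ?_) (Real.exp_pos _).le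
          ((norm_nonneg _).trans h2.le)
        rw [← Complex.ofReal_pow, Complex.re_ofReal_mul]
        nlinarith [sq_nonneg s]
      · rw [Set.indicator_of_notMem hs, norm_zero]
        have : 0 ≤ M := (norm_nonneg _).trans (hM 0 (by simp [hb.le]))
        positivity
    · have h0 : Tendsto (fun p : ℕ × X ↦ (√p.1)⁻¹ * s) (atTop ×ˢ 𝓝 x₀) (𝓝 0) := by
        rw [← zero_mul s]
        refine Tendsto.mul_const s ?_
        exact (tendsto_inv_atTop_zero.comp (Real.tendsto_sqrt_atTop.comp
          tendsto_natCast_atTop_atTop)).comp tendsto_fst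
      have hpair : Tendsto (fun p : ℕ × X ↦ (p.2, (√p.1)⁻¹ * s)) (atTop ×ˢ 𝓝 x₀)
          (𝓝 (x₀, 0)) := tendsto_snd.prodMk_nhds h0
      have hlim : Tendsto (fun p : ℕ × X ↦ q p.2 ((√p.1)⁻¹ * s) *
          Complex.exp (s ^ 2 * R p.2 ((√p.1)⁻¹ * s))) (atTop ×ˢ 𝓝 x₀)
          (𝓝 (q x₀ 0 * Complex.exp (s ^ 2 * R x₀ 0))) :=
        ((hq.tendsto (x₀, 0)).comp hpair).mul
          ((((hR.tendsto (x₀, 0)).comp hpair).const_mul _).cexp)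
      refine hlim.congr' ?_
      filter_upwards [h0.eventually (Ioo_mem_nhds (neg_lt_zero.2 hb) hb)] with p hp
      rw [Set.indicator_of_mem (Set.Ioo_subset_Ioc_self hp)]
  refine hdct.congr' ?_
  filter_upwards [hnev.prod_inl (𝓝 x₀)] with p hp
  exact (sqrt_mul_integral_eq hp _ _ hb.le).symm

end Laplace

section Cauchy

open Metric

lemma norm_deriv_le_of_norm_le_ball {f : ℂ → ℂ} {a z : ℂ} {r C : ℝ}
    (hf : DifferentiableOn ℂ f (ball a r)) (hC : ∀ w ∈ ball a r, ‖f w‖ ≤ C)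
    (hz : z ∈ ball a (r / 2)) : ‖deriv f z‖ ≤ C / (r / 4) := by
  have hr : 0 < r := by linarith [pos_of_mem_ball hz]
  have hsub : closedBall z (r / 4) ⊆ ball a r := by
    refine closedBall_subset_ball' ?_
    linarith [mem_ball.1 hz]
  refine Complex.norm_deriv_le_of_forall_mem_sphere_norm_le (by positivity) ?_
    fun w hw ↦ hC w (hsub (sphere_subset_closedBall hw))
  exact (hf.mono hsub).diffContOnCl_ball subset_rfl

/-- If `Z n` converges to a nonzero constant, locally uniformly near `a`, then the derivatives
at `a` of the logarithmic derivatives of `Z n`, divided by `ρ`, stay bounded. -/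
lemma exists_norm_deriv_logDeriv_div_le {Z : ℕ → ℂ → ℂ} {a c : ℂ} {ρ : ℂ → ℂ}
    (hZ : ∀ᶠ z in 𝓝 a, ∀ n, DifferentiableAt ℂ (Z n) z)
    (hlim : Tendsto (fun p : ℕ × ℂ ↦ Z p.1 p.2) (atTop ×ˢ 𝓝 a) (𝓝 c)) (hc : c ≠ 0)
    (hρ : ∀ᶠ z in 𝓝 a, DifferentiableAt ℂ ρ z) (hρa : ρ a ≠ 0) :
    ∃ K : ℝ, ∀ᶠ n in atTop, ‖deriv (fun z ↦ logDeriv (Z n) z / ρ z) a‖ ≤ K ∧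
      ∀ᶠ z in 𝓝 a, Z n z ≠ 0 ∧ DifferentiableAt ℂ (fun z ↦ logDeriv (Z n) z / ρ z) z := by
  have hc' : 0 < ‖c‖ / 2 := by positivity
  have hρ' : 0 < ‖ρ a‖ / 2 := by positivity
  have h1 : ∀ᶠ z in 𝓝 a, ‖ρ a‖ / 2 < ‖ρ z‖ :=
    hρ.self_of_nhds.continuousAt.norm.eventually_const_lt (by linarith)
  obtain ⟨s, hs, t, ht, hst⟩ := eventually_prod_iff.1
    ((hlim.norm.eventually_const_lt (by linarith : ‖c‖ / 2 < ‖c‖)).and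
      (hlim.norm.eventually_lt_const (by linarith : ‖c‖ < 2 * ‖c‖)))
  obtain ⟨r, hr, hball⟩ := Metric.eventually_nhds_iff_ball.1 (hZ.and (ht.and (hρ.and h1)))
  refine ⟨2 * ‖c‖ / (r / 4) / (‖c‖ / 2) / (‖ρ a‖ / 2) / (r / 2 / 4), hs.mono fun n hn ↦ ?_⟩
  have hZd : DifferentiableOn ℂ (Z n) (ball a r) :=
    fun z hz ↦ ((hball z hz).1 n).differentiableWithinAt
  have hZ0 : ∀ z ∈ ball a r, ‖c‖ / 2 < ‖Z n z‖ := fun z hz ↦ (hst hn (hball z hz).2.1).1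
  have hsub : ball a (r / 2) ⊆ ball a r := ball_subset_ball (by linarith)
  have hZne : ∀ z ∈ ball a r, Z n z ≠ 0 := fun z hz ↦ norm_pos_iff.1 (hc'.trans (hZ0 z hz))
  have hρne : ∀ z ∈ ball a r, ρ z ≠ 0 :=
    fun z hz ↦ norm_pos_iff.1 (hρ'.trans (hball z hz).2.2.2)
  have hd : ∀ z ∈ ball a r, DifferentiableAt ℂ (fun z ↦ logDeriv (Z n) z / ρ z) z := by
    intro z hz
    have h2 : DifferentiableAt ℂ (deriv (Z n)) z :=
      (hZd.deriv isOpen_ball).differentiableAt (isOpen_ball.mem_nhds hz)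
    exact (h2.div ((hball z hz).1 n) (hZne z hz)).div (hball z hz).2.2.1 (hρne z hz)
  refine ⟨norm_deriv_le_of_norm_le_ball (r := r / 2) (fun z hz ↦ ?_) (fun z hz ↦ ?_)
    (mem_ball_self (by positivity)), eventually_nhds_iff_ball.2 ⟨r, hr, fun z hz ↦
      ⟨hZne z hz, hd z hz⟩⟩⟩
  · exact (hd z (hsub hz)).differentiableWithinAt
  · have h2 : ‖deriv (Z n) z‖ ≤ 2 * ‖c‖ / (r / 4) :=
      norm_deriv_le_of_norm_le_ball hZd (fun w hw ↦ (hst hn (hball w hw).2.1).2.le) hz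
    rw [norm_div, logDeriv_apply, norm_div]
    have h3 := hZ0 z (hsub hz)
    have h4 := (hball z (hsub hz)).2.2.2
    gcongr

end Cauchy

/-- The derivative `t ∂/∂t` of `eulerDominated`. -/
noncomputable def eulerEulerDominated (u t : ℂ) : ℂ :=
  outsideSeries u t * ((1 + insideSeries u t * (1 + t)) ^ 2 + insideSeries u t * (1 + t) ^ 2 +
    insideSeries u t * t) - t

/-- The remainder in the expansion of `dominatedSeries u` to second order along the circle through
`τ`. -/
noncomputable def quadraticPhase (p : ℂ × ℂ) (θ : ℝ) : ℂ :=
  -∫ s : ℝ in 0..1, (1 - s) * eulerEulerDominated p.1 (p.2 * Complex.exp (s * θ * Complex.I))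

/-- `saddleAmplitude` along the circle through `τ`. -/
noncomputable def circleAmplitude (p : ℂ × ℂ) (θ : ℝ) : ℂ :=
  saddleAmplitude p.1 (p.2 * Complex.exp (θ * Complex.I))

section phase

open Complex

@[fun_prop] lemma continuous_insideSeries₂ : Continuous fun p : ℂ × ℂ ↦ insideSeries p.1 p.2 := by
  unfold insideSeries; fun_prop

@[fun_prop] lemma continuous_outsideSeries₂ :
    Continuous fun p : ℂ × ℂ ↦ outsideSeries p.1 p.2 := by
  unfold outsideSeries; fun_prop

@[fun_prop] lemma continuous_dominatedSeries₂ :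
    Continuous fun p : ℂ × ℂ ↦ dominatedSeries p.1 p.2 := by
  unfold dominatedSeries; fun_prop

@[fun_prop] lemma continuous_treeSeries₂ : Continuous fun p : ℂ × ℂ ↦ treeSeries p.1 p.2 := by
  unfold treeSeries; fun_prop

@[fun_prop] lemma continuous_eulerDominated₂ :
    Continuous fun p : ℂ × ℂ ↦ eulerDominated p.1 p.2 := by
  unfold eulerDominated; fun_prop

@[fun_prop] lemma continuous_eulerEulerDominated₂ :
    Continuous fun p : ℂ × ℂ ↦ eulerEulerDominated p.1 p.2 := by
  unfold eulerEulerDominated; fun_prop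

lemma saddleAmplitude_eq (u t : ℂ) : saddleAmplitude u t =
    (insideSeries u t * (1 + t) + eulerDominated u t +
      (insideSeries u t + dominatedSeries u t) ^ 2 * (1 - eulerDominated u t)) *
      exp (treeSeries u t) := by
  have hA := (differentiable_insideSeries u t).hasDerivAt
  have hB := (differentiable_dominatedSeries u t).hasDerivAt
  have hT := (differentiable_treeSeries u t).hasDerivAt
  have h := ((hA.add hB).mul hT.cexp).deriv
  have h' : deriv (fun t ↦ (insideSeries u t + dominatedSeries u t) * exp (treeSeries u t)) t = _ :=
    h
  rw [saddleAmplitude, h', ← mul_deriv_insideSeries, ← mul_deriv_dominatedSeries]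
  simp only [Pi.add_apply]
  linear_combination (insideSeries u t + dominatedSeries u t) * exp (treeSeries u t) *
    (mul_deriv_treeSeries u t + (insideSeries u t + dominatedSeries u t) *
      mul_deriv_dominatedSeries u t)

lemma continuous_circleAmplitude : Continuous ↿circleAmplitude := by
  have : Continuous fun p : ℂ × ℂ ↦ saddleAmplitude p.1 p.2 := by
    simp only [saddleAmplitude_eq]
    fun_prop
  exact this.comp (f := fun p : (ℂ × ℂ) × ℝ ↦ (p.1.1, p.1.2 * exp (p.2 * I))) (by fun_prop)

lemma continuous_quadraticPhase : Continuous ↿quadraticPhase := by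
  refine Continuous.neg ?_
  refine intervalIntegral.continuous_parametric_intervalIntegral_of_continuous'
    (f := fun (p : (ℂ × ℂ) × ℝ) (s : ℝ) ↦
      (1 - s) * eulerEulerDominated p.1.1 (p.1.2 * exp (s * p.2 * I))) ?_ 0 1
  have h := continuous_eulerEulerDominated₂.comp
    (f := fun p : ((ℂ × ℂ) × ℝ) × ℝ ↦ (p.1.1.1, p.1.1.2 * exp (p.2 * p.1.2 * I))) (by fun_prop)
  exact (by fun_prop : Continuous fun p : ((ℂ × ℂ) × ℝ) × ℝ ↦ (1 - p.2 : ℂ)).mul h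

lemma mul_deriv_eulerDominated (u t : ℂ) :
    t * deriv (eulerDominated u) t = eulerEulerDominated u t := by
  have hA := (differentiable_insideSeries u t).hasDerivAt
  have hD := (differentiable_outsideSeries u t).hasDerivAt
  have hid := hasDerivAt_id t
  have h := ((hD.mul ((hA.mul (hid.const_add 1)).const_add 1)).sub hid).deriv
  have h' : deriv (eulerDominated u) t = _ := h
  rw [h', eulerEulerDominated]
  have h1 := mul_deriv_insideSeries u t
  have h2 := mul_deriv_outsideSeries u t
  rw [eulerDominated] at h2
  simp only [id, Pi.mul_apply]
  linear_combination (1 + insideSeries u t * (1 + t)) * h2 + outsideSeries u t * (1 + t) * h1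

lemma dominatedSeries_circle_eq (u τ : ℂ) (θ : ℝ) :
    dominatedSeries u (τ * exp (θ * I)) - dominatedSeries u τ - θ * I * eulerDominated u τ =
      θ ^ 2 * quadraticPhase (u, τ) θ := by
  set w : ℝ → ℂ := fun s ↦ τ * exp (s * θ * I) with hw
  have hwd (s : ℝ) : HasDerivAt w (w s * (θ * I)) s := by
    have h1 : HasDerivAt (fun s : ℝ ↦ (s : ℂ) * θ * I) (1 * θ * I) s :=
      ((hasDerivAt_id s).ofReal_comp.mul_const _).mul_const _
    convert! h1.cexp.const_mul τ using 1
    simp only [hw]; ring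
  have hf (s : ℝ) : HasDerivAt (fun s ↦ dominatedSeries u (w s))
      (θ * I * eulerDominated u (w s)) s := by
    convert! (differentiable_dominatedSeries u (w s)).hasDerivAt.comp s (hwd s) using 1
    rw [← mul_deriv_dominatedSeries]; ring
  have he (s : ℝ) : HasDerivAt (fun s ↦ eulerDominated u (w s))
      (θ * I * eulerEulerDominated u (w s)) s := by
    convert! (differentiable_eulerDominated u (w s)).hasDerivAt.comp s (hwd s) using 1
    rw [← mul_deriv_eulerDominated]; ring
  have hG (s : ℝ) : HasDerivAt
      (fun s : ℝ ↦ (1 - s) * (θ * I * eulerDominated u (w s)) + dominatedSeries u (w s))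
      (-θ ^ 2 * ((1 - s) * eulerEulerDominated u (w s))) s := by
    convert! (((hasDerivAt_id s).ofReal_comp.const_sub 1).mul ((he s).const_mul (θ * I))).add
      (hf s) using 1
    simp only [id]
    push_cast
    linear_combination -(1 - s) * θ ^ 2 * eulerEulerDominated u (w s) * I_sq
  have hc : Continuous fun s : ℝ ↦ -θ ^ 2 * ((1 - s) * eulerEulerDominated u (w s)) := by
    have h := continuous_eulerEulerDominated₂.comp (f := fun s : ℝ ↦ (u, w s)) (by fun_prop)
    exact continuous_const.mul ((by fun_prop : Continuous fun s : ℝ ↦ (1 - s : ℂ)).mul h)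
  have h := intervalIntegral.integral_eq_sub_of_hasDerivAt (fun s _ ↦ hG s)
    (hc.intervalIntegrable 0 1)
  rw [intervalIntegral.integral_const_mul] at h
  simp only [quadraticPhase]
  simp only [hw, ofReal_one, ofReal_zero, one_mul, zero_mul, exp_zero, mul_one, sub_zero,
    sub_self, zero_add] at h
  linear_combination -h

lemma quadraticPhase_zero (u τ : ℂ) :
    quadraticPhase (u, τ) 0 = -(eulerEulerDominated u τ / 2) := by
  have h : ∫ s : ℝ in 0..1, (1 - s : ℂ) = 1 / 2 := by
    have : ∫ s : ℝ in 0..1, (1 - s : ℝ) = 1 / 2 := by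
      rw [intervalIntegral.integral_sub (by simp) (by simp)]; norm_num
    simp only [← ofReal_one, ← ofReal_sub]
    rw [intervalIntegral.integral_ofReal, this]
    push_cast
    rfl
  simp [quadraticPhase, h]
  ring

lemma sq_mul_sizePolynomial_eq_integral {u τ : ℂ} (hτ : τ ≠ 0) (h : eulerDominated u τ = 1)
    (n : ℕ) : (n : ℂ) ^ 2 * sizePolynomial n u =
      n.factorial * (exp (dominatedSeries u τ) / τ) ^ n * (((2 * Real.pi)⁻¹ : ℝ) *
        ∫ θ in (-Real.pi)..Real.pi,
          circleAmplitude (u, τ) θ * exp (n * θ ^ 2 * quadraticPhase (u, τ) θ)) := by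
  rw [sq_mul_sizePolynomial hτ, Real.circleAverage_def]
  have hper : Function.Periodic (fun θ ↦ saddleAmplitude u (τ * circleMap 0 1 θ) *
      exp (n * dominatedSeries u (τ * circleMap 0 1 θ)) / (τ * circleMap 0 1 θ) ^ n)
      (2 * Real.pi) := fun θ ↦ by simp only [periodic_circleMap 0 1 θ]
  have h1 := hper.intervalIntegral_add_eq 0 (-Real.pi)
  rw [zero_add, show -Real.pi + 2 * Real.pi = Real.pi by ring] at h1
  rw [h1, mul_assoc, mul_left_comm _ (((2 * Real.pi)⁻¹ : ℝ) : ℂ),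
    ← intervalIntegral.integral_const_mul, real_smul]
  congr 3
  ext θ
  have h2 : (exp (dominatedSeries u τ) / τ) ^ n * exp (n * θ ^ 2 * quadraticPhase (u, τ) θ) =
      exp (n * dominatedSeries u (τ * exp (θ * I))) / (τ * exp (θ * I)) ^ n := by
    rw [mul_assoc (n : ℂ), ← dominatedSeries_circle_eq, h, div_pow, mul_pow, ← exp_nat_mul,
      ← exp_nat_mul, div_mul_eq_mul_div, ← exp_add, mul_comm (τ ^ n), ← div_div, ← exp_sub]
    congr 2
    ring
  simp only [circleMap_zero, ofReal_one, one_mul, circleAmplitude]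
  rw [mul_left_comm, h2, mul_div_assoc]

lemma norm_exp_sub_one_le_exp_norm_sub_one (z : ℂ) : ‖exp z - 1‖ ≤ Real.exp ‖z‖ - 1 := by
  simpa using norm_exp_sub_sum_le_exp_norm_sub_sum z 1

lemma re_quadraticPhase_neg {τ : ℝ} (hτ : 0 < τ) (h : eulerDominated 1 τ = 1) {θ : ℝ}
    (hθ : θ ∈ Set.Icc (-Real.pi) Real.pi) : (quadraticPhase (1, (τ : ℂ)) θ).re < 0 := by
  have hA : insideSeries 1 τ = (τ * Real.exp τ : ℝ) := by simp [insideSeries]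
  have hA0 : 0 < τ * Real.exp τ := by positivity
  rcases eq_or_ne θ 0 with rfl | hθ0
  · have : quadraticPhase (1, (τ : ℂ)) 0 = (-((τ * Real.exp (τ * Real.exp τ) *
        ((1 + τ * Real.exp τ * (1 + τ)) ^ 2 + τ * Real.exp τ * (1 + τ) ^ 2 +
          τ * Real.exp τ * τ) - τ) / 2) : ℝ) := by
      rw [quadraticPhase_zero, eulerEulerDominated, outsideSeries, hA]
      push_cast
      ring
    rw [this, ofReal_re]
    have h1 : 1 < Real.exp (τ * Real.exp τ) := Real.one_lt_exp_iff.2 hA0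
    have h2 : 1 < (1 + τ * Real.exp τ * (1 + τ)) ^ 2 + τ * Real.exp τ * (1 + τ) ^ 2 +
          τ * Real.exp τ * τ := by
      have : 0 < τ * Real.exp τ * (1 + τ) := by positivity
      have : 0 < τ * Real.exp τ * (1 + τ) ^ 2 := by positivity
      have : 0 < τ * Real.exp τ * τ := by positivity
      nlinarith
    have h3 := mul_lt_mul_of_pos_left (one_lt_mul_of_lt_of_le h1 h2.le) hτ
    nlinarith
  · have hcos : Real.cos θ < 1 := by
      refine lt_of_le_of_ne (Real.cos_le_one θ) fun hc ↦ hθ0 ?_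
      exact (Real.cos_eq_one_iff_of_lt_of_lt (by linarith [hθ.1, Real.pi_pos])
        (by linarith [hθ.2, Real.pi_pos])).1 hc
    have hre := congrArg re (dominatedSeries_circle_eq 1 τ θ)
    rw [← ofReal_pow, re_ofReal_mul, h] at hre
    have hB : dominatedSeries 1 τ = (τ * (Real.exp (τ * Real.exp τ) - 1) : ℝ) := by
      rw [dominatedSeries, outsideSeries, hA]; push_cast; ring
    have hn : ‖(τ : ℂ) * exp (θ * I)‖ = τ := by
      rw [norm_mul, norm_exp_ofReal_mul_I, mul_one, norm_real, Real.norm_of_nonneg hτ.le]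
    have hnA : ‖insideSeries 1 (τ * exp (θ * I))‖ < τ * Real.exp τ := by
      rw [insideSeries, one_mul, norm_mul, hn, norm_exp, re_ofReal_mul, exp_ofReal_mul_I_re]
      refine mul_lt_mul_of_pos_left (Real.exp_lt_exp.2 ?_) hτ
      nlinarith
    have hnB : (dominatedSeries 1 (τ * exp (θ * I))).re < τ * (Real.exp (τ * Real.exp τ) - 1) := by
      have : dominatedSeries 1 (τ * exp (θ * I)) =
          τ * exp (θ * I) * (exp (insideSeries 1 (τ * exp (θ * I))) - 1) := by
        rw [dominatedSeries, outsideSeries]; ring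
      refine (re_le_norm _).trans_lt ?_
      rw [this, norm_mul, hn]
      refine mul_lt_mul_of_pos_left ((norm_exp_sub_one_le_exp_norm_sub_one _).trans_lt ?_) hτ
      linarith [Real.exp_lt_exp.2 hnA]
    rw [hB] at hre
    simp only [sub_re, ofReal_re, mul_one, mul_re, I_re, mul_zero, ofReal_im, I_im, sub_self,
      sub_zero] at hre
    by_contra! hcon
    have := mul_nonneg (sq_nonneg θ) hcon
    linarith

end phase

section saddle

open Complex

lemma exists_saddle : ∃ a τ : ℝ, 0 < a ∧ 0 < τ ∧ a = τ * Real.exp τ ∧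
    a * Real.exp a * τ ^ 2 + (Real.exp a - 1 + a * Real.exp a) * τ = 1 := by
  set f : ℝ → ℝ := fun τ ↦ τ * Real.exp τ * Real.exp (τ * Real.exp τ) * τ ^ 2 +
    (Real.exp (τ * Real.exp τ) - 1 + τ * Real.exp τ * Real.exp (τ * Real.exp τ)) * τ with hf
  have h0 : f 0 = 0 := by simp [hf]
  have h1 : 1 ≤ f 1 := by
    have h2 : 1 ≤ Real.exp 1 := Real.one_le_exp zero_le_one
    have h3 : 1 ≤ Real.exp (Real.exp 1) := Real.one_le_exp (Real.exp_pos _).le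
    simp only [hf, one_mul, one_pow, mul_one]
    nlinarith [mul_le_mul h2 h3 zero_le_one (by positivity)]
  obtain ⟨τ, hτ, hτ1⟩ := intermediate_value_Icc (zero_le_one' ℝ)
    (by fun_prop : ContinuousOn f (Set.Icc 0 1)) ⟨h0.le.trans zero_le_one, h1⟩
  have hτ0 : 0 < τ := by
    refine lt_of_le_of_ne hτ.1 ?_
    rintro rfl
    rw [h0] at hτ1
    exact zero_ne_one hτ1
  exact ⟨τ * Real.exp τ, τ, by positivity, hτ0, rfl, hτ1⟩

lemma exists_saddleRadius {a τ₀ : ℝ} (ha : 0 < a) (hτ₀ : 0 < τ₀)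
    (h : a * Real.exp a * τ₀ ^ 2 + (Real.exp a - 1 + a * Real.exp a) * τ₀ = 1) :
    ∃ τ : ℂ → ℂ, τ a = τ₀ ∧ ∀ᶠ z in 𝓝 (a : ℂ), DifferentiableAt ℂ τ z ∧
      z * exp z * τ z ^ 2 + (exp z - 1 + z * exp z) * τ z = 1 := by
  set b : ℂ → ℂ := fun z ↦ exp z - 1 + z * exp z with hb
  set d : ℂ → ℂ := fun z ↦ b z ^ 2 + 4 * (z * exp z) with hd
  have hE : 1 < Real.exp a := Real.one_lt_exp_iff.2 ha
  have hba : b a = (Real.exp a - 1 + a * Real.exp a : ℝ) := by simp [hb]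
  have hb0 : 0 < Real.exp a - 1 + a * Real.exp a := by
    have : 0 < a * Real.exp a := by positivity
    linarith
  have hda : d a = ((2 * a * Real.exp a * τ₀ + (Real.exp a - 1 + a * Real.exp a) : ℝ) : ℂ) ^ 2 := by
    simp only [hd, hba]
    norm_cast
    linear_combination -4 * a * Real.exp a * h
  have hr0 : 0 < 2 * a * Real.exp a * τ₀ + (Real.exp a - 1 + a * Real.exp a) := by positivity
  have hrootd : d a ^ (2⁻¹ : ℂ) =
      (2 * a * Real.exp a * τ₀ + (Real.exp a - 1 + a * Real.exp a) : ℝ) := by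
    rw [hda]
    exact sq_cpow_two_inv (by rwa [ofReal_re])
  have hslit : d a ∈ slitPlane := by
    rw [hda, ← ofReal_pow, ofReal_mem_slitPlane]
    positivity
  have hbd (z : ℂ) : DifferentiableAt ℂ b z := by fun_prop
  have hdd (z : ℂ) : DifferentiableAt ℂ d z := by fun_prop
  have hden : b a + d a ^ (2⁻¹ : ℂ) ≠ 0 := by
    rw [hrootd, hba, ← ofReal_add, ofReal_ne_zero]
    positivity
  have hev1 : ∀ᶠ z in 𝓝 (a : ℂ), d z ∈ slitPlane :=
    (hdd a).continuousAt.eventually_mem (isOpen_slitPlane.mem_nhds hslit)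
  have hev2 : ∀ᶠ z in 𝓝 (a : ℂ), b z + d z ^ (2⁻¹ : ℂ) ≠ 0 :=
    ((hbd a).continuousAt.add ((hdd a).cpow_const (c := 2⁻¹) hslit).continuousAt).eventually_ne hden
  refine ⟨fun z ↦ 2 / (b z + d z ^ (2⁻¹ : ℂ)), ?_, ?_⟩
  · rw [div_eq_iff hden, hrootd, hba]
    norm_cast
    have : τ₀ * (2 * (a * Real.exp a * τ₀) + 2 * (Real.exp a - 1 + a * Real.exp a)) = 2 := by
      linear_combination 2 * h
    linarith
  · filter_upwards [hev1, hev2] with z h1 h2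
    refine ⟨(differentiableAt_const _).div ((hbd z).add ((hdd z).cpow_const h1)) h2, ?_⟩
    have hsq : (d z ^ (2⁻¹ : ℂ)) ^ 2 = d z := by
      simp
    change z * exp z * _ + b z * _ = 1
    generalize d z ^ (2⁻¹ : ℂ) = r at *
    field_simp
    simp only [hd] at hsq
    linear_combination -hsq

section parametrization

variable {τ : ℂ → ℂ} {z : ℂ}

lemma insideSeries_saddle (hτ : τ z ≠ 0) : insideSeries (z / (τ z * exp (τ z))) (τ z) = z := by
  have := exp_ne_zero (τ z)
  rw [insideSeries]
  field_simp

lemma dominatedSeries_saddle (hτ : τ z ≠ 0) :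
    dominatedSeries (z / (τ z * exp (τ z))) (τ z) = τ z * (exp z - 1) := by
  rw [dominatedSeries, outsideSeries, insideSeries_saddle hτ]
  ring

lemma eulerDominated_saddle (hτ : τ z ≠ 0)
    (h : z * exp z * τ z ^ 2 + (exp z - 1 + z * exp z) * τ z = 1) :
    eulerDominated (z / (τ z * exp (τ z))) (τ z) = 1 := by
  rw [eulerDominated, outsideSeries, insideSeries_saddle hτ]
  linear_combination h

lemma saddleRadius_ne_zero (h : z * exp z * τ z ^ 2 + (exp z - 1 + z * exp z) * τ z = 1) :
    τ z ≠ 0 := by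
  intro h0
  simp [h0] at h

lemma logDeriv_saddleMark (hd : DifferentiableAt ℂ τ z) (hτ : τ z ≠ 0) (hz : z ≠ 0) :
    logDeriv (fun z ↦ z / (τ z * exp (τ z))) z = 1 / z - deriv τ z / τ z - deriv τ z := by
  have := exp_ne_zero (τ z)
  have h := (hasDerivAt_id z).div (hd.hasDerivAt.mul hd.hasDerivAt.cexp) (mul_ne_zero hτ this)
  have h' : deriv (fun z ↦ z / (τ z * exp (τ z))) z = _ := h.deriv
  rw [logDeriv_apply, h']
  simp only [id, Pi.mul_apply]
  field_simp
  ring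

lemma logDeriv_saddleBase (hd : DifferentiableAt ℂ τ z) (hz : z ≠ 0)
    (h : z * exp z * τ z ^ 2 + (exp z - 1 + z * exp z) * τ z = 1) :
    logDeriv (fun z ↦ exp (τ z * (exp z - 1)) / τ z) z =
      τ z * z * exp z * logDeriv (fun z ↦ z / (τ z * exp (τ z))) z := by
  have hτ := saddleRadius_ne_zero h
  have hn := exp_ne_zero (τ z * (exp z - 1))
  rw [logDeriv_saddleMark hd hτ hz]
  have h1 := ((hd.hasDerivAt.mul ((hasDerivAt_exp z).sub_const 1)).cexp).div hd.hasDerivAt hτ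
  have h' : deriv (fun z ↦ exp (τ z * (exp z - 1)) / τ z) z = _ := h1.deriv
  rw [logDeriv_apply, h']
  simp only [Pi.mul_apply]
  field_simp
  linear_combination deriv τ z * h

lemma deriv_saddleRadius (h : ∀ᶠ z in 𝓝 z, DifferentiableAt ℂ τ z ∧
      z * exp z * τ z ^ 2 + (exp z - 1 + z * exp z) * τ z = 1) :
    (1 + z) * exp z * τ z ^ 2 + (2 + z) * exp z * τ z +
      (2 * z * exp z * τ z + (exp z - 1 + z * exp z)) * deriv τ z = 0 := by
  have hd := h.self_of_nhds.1.hasDerivAt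
  have hE := hasDerivAt_exp z
  have hid := hasDerivAt_id z
  have h1 := (((hid.mul hE).mul (hd.pow 2)).add
    (((hE.sub_const 1).add (hid.mul hE)).mul hd)).deriv
  have h2 : deriv (fun z ↦ z * exp z * τ z ^ 2 + (exp z - 1 + z * exp z) * τ z) z = 0 := by
    rw [EventuallyEq.deriv_eq (f := fun _ ↦ 1) (h.mono fun z hz ↦ hz.2), deriv_const]
  have h3 := h1.symm.trans h2
  simp only [id, Pi.mul_apply, Pi.add_apply, Pi.pow_apply] at h3
  push_cast at h3
  linear_combination h3

end parametrization

end saddle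

/-- `sizePolynomial n` along the curve of saddle points, divided by its order of growth. -/
noncomputable def normalizedPolynomial (τ : ℂ → ℂ) (n : ℕ) (z : ℂ) : ℂ :=
  (√n : ℂ) * (n ^ 2 * sizePolynomial n (z / (τ z * Complex.exp (τ z)))) /
    (n.factorial * (Complex.exp (τ z * (Complex.exp z - 1)) / τ z) ^ n)

section asymptotics

open Complex

lemma differentiableAt_normalizedPolynomial {τ : ℂ → ℂ} {z : ℂ} (hd : DifferentiableAt ℂ τ z)
    (hτ : τ z ≠ 0) (n : ℕ) : DifferentiableAt ℂ (normalizedPolynomial τ n) z := by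
  have hn := exp_ne_zero (τ z)
  have h1 : DifferentiableAt ℂ (fun z ↦ z / (τ z * exp (τ z))) z := by fun_prop (disch := simp_all)
  have h2 : DifferentiableAt ℂ (fun z ↦ sizePolynomial n (z / (τ z * exp (τ z)))) z :=
    (differentiable_sizePolynomial n _).comp z h1
  have h3 : DifferentiableAt ℂ (fun z ↦ exp (τ z * (exp z - 1)) / τ z) z := by
    fun_prop (disch := simp_all)
  exact ((h2.const_mul _).const_mul _).div ((h3.pow n).const_mul _)
    (mul_ne_zero (by exact_mod_cast n.factorial_ne_zero)
      (pow_ne_zero _ (div_ne_zero (exp_ne_zero _) hτ)))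

lemma normalizedPolynomial_eq {τ : ℂ → ℂ} {z : ℂ}
    (h : z * exp z * τ z ^ 2 + (exp z - 1 + z * exp z) * τ z = 1) (n : ℕ) :
    normalizedPolynomial τ n z = ((2 * Real.pi)⁻¹ : ℝ) * ((√n : ℂ) *
      ∫ θ in (-Real.pi)..Real.pi, circleAmplitude (z / (τ z * exp (τ z)), τ z) θ *
        exp (n * θ ^ 2 * quadraticPhase (z / (τ z * exp (τ z)), τ z) θ)) := by
  have hτ := saddleRadius_ne_zero h
  have hn : (n.factorial : ℂ) ≠ 0 := by exact_mod_cast n.factorial_ne_zero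
  have hy : exp (τ z * (exp z - 1)) / τ z ≠ 0 := div_ne_zero (exp_ne_zero _) hτ
  rw [normalizedPolynomial, sq_mul_sizePolynomial_eq_integral hτ (eulerDominated_saddle hτ h),
    dominatedSeries_saddle hτ, div_eq_iff (mul_ne_zero hn (pow_ne_zero n hy))]
  ring

lemma tendsto_normalizedPolynomial {a τ₀ : ℝ} {τ : ℂ → ℂ} (ha : 0 < a) (hτ₀ : 0 < τ₀)
    (haτ : a = τ₀ * Real.exp τ₀) (hτa : τ a = τ₀)
    (h : ∀ᶠ z in 𝓝 (a : ℂ), DifferentiableAt ℂ τ z ∧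
      z * exp z * τ z ^ 2 + (exp z - 1 + z * exp z) * τ z = 1) :
    ∃ c ≠ 0, Tendsto (fun p : ℕ × ℂ ↦ normalizedPolynomial τ p.1 p.2) (atTop ×ˢ 𝓝 (a : ℂ))
      (𝓝 c) := by
  have hτ := saddleRadius_ne_zero h.self_of_nhds.2
  have hu : (a : ℂ) / (τ a * exp (τ a)) = 1 := by
    rw [div_eq_one_iff_eq (mul_ne_zero hτ (exp_ne_zero _)), hτa, haτ]
    push_cast
    rfl
  have heuler : eulerDominated 1 τ₀ = 1 := by
    have := eulerDominated_saddle hτ h.self_of_nhds.2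
    rwa [hu, hτa] at this
  have hinside : insideSeries 1 τ₀ = a := by
    have := insideSeries_saddle hτ
    rwa [hu, hτa] at this
  have hcont : Tendsto (fun z ↦ (z / (τ z * exp (τ z)), τ z)) (𝓝 (a : ℂ)) (𝓝 (1, (τ₀ : ℂ))) := by
    have h1 : ContinuousAt τ a := h.self_of_nhds.1.continuousAt
    have h2 : ContinuousAt (fun z ↦ (z / (τ z * exp (τ z)), τ z)) (a : ℂ) :=
      (continuousAt_id.div (h1.mul h1.cexp) (mul_ne_zero hτ (exp_ne_zero _))).prodMk h1
    have h3 := h2.tendsto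
    rwa [hu, hτa] at h3
  have hlim := (tendsto_sqrt_mul_integral continuous_circleAmplitude continuous_quadraticPhase
    Real.pi_pos fun θ hθ ↦ re_quadraticPhase_neg hτ₀ heuler hθ).comp
      (tendsto_id.prodMap hcont)
  have hneg := re_quadraticPhase_neg hτ₀ heuler (θ := 0) ⟨by simp [Real.pi_pos.le], Real.pi_pos.le⟩
  refine ⟨_, ?_, (hlim.const_mul (((2 * Real.pi)⁻¹ : ℝ) : ℂ)).congr' ?_⟩
  · refine mul_ne_zero (ofReal_ne_zero.2 (by positivity)) ?_
    rw [integral_const_mul]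
    refine mul_ne_zero ?_ ?_
    · have : circleAmplitude (1, (τ₀ : ℂ)) 0 = (a * (1 + τ₀) + 1 : ℝ) * exp (treeSeries 1 τ₀) := by
        simp [circleAmplitude, saddleAmplitude_eq, heuler, hinside]
      rw [this]
      exact mul_ne_zero (ofReal_ne_zero.2 (by positivity)) (exp_ne_zero _)
    · have hg := integral_gaussian_complex (b := -quadraticPhase (1, (τ₀ : ℂ)) 0)
        (by simpa using hneg)
      have he : (fun s : ℝ ↦ exp (s ^ 2 * quadraticPhase (1, (τ₀ : ℂ)) 0)) =
          fun s : ℝ ↦ exp (- -quadraticPhase (1, (τ₀ : ℂ)) 0 * s ^ 2) := by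
        ext s; rw [neg_neg, mul_comm]
      rw [he, hg, cpow_ne_zero_iff_of_exponent_ne_zero (by norm_num)]
      refine div_ne_zero (ofReal_ne_zero.2 Real.pi_ne_zero) (neg_ne_zero.2 fun h0 ↦ ?_)
      simp [h0] at hneg
  · filter_upwards [h.prod_inr atTop] with p hp
    exact (normalizedPolynomial_eq hp.2 p.1).symm

/-- The logarithmic derivative does not see constant factors. -/
lemma logDeriv_const_mul_div_const_mul_pow {p y : ℂ → ℂ} {z k₁ k₂ k₃ : ℂ} (hk₁ : k₁ ≠ 0)
    (hk₂ : k₂ ≠ 0) (hk₃ : k₃ ≠ 0) (hp : DifferentiableAt ℂ p z) (hy : DifferentiableAt ℂ y z)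
    (hpz : p z ≠ 0) (hyz : y z ≠ 0) (n : ℕ) :
    logDeriv (fun z ↦ k₁ * (k₂ * p z) / (k₃ * y z ^ n)) z =
      logDeriv p z - n * logDeriv y z := by
  rw [logDeriv_div (f := fun z ↦ k₁ * (k₂ * p z)) (g := fun z ↦ k₃ * y z ^ n) z
      (mul_ne_zero hk₁ (mul_ne_zero hk₂ hpz)) (mul_ne_zero hk₃ (pow_ne_zero n hyz))
      ((hp.const_mul k₂).const_mul k₁) ((hy.fun_pow n).const_mul k₃),
    logDeriv_const_mul (f := fun z ↦ k₂ * p z) z k₁ hk₁, logDeriv_const_mul z k₂ hk₂,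
    logDeriv_const_mul (f := fun z ↦ y z ^ n) z k₃ hk₃, logDeriv_fun_pow hy]

lemma mul_logDeriv_sizePolynomial_eq {τ : ℂ → ℂ} {z : ℂ} (hz : z ≠ 0)
    (hd : DifferentiableAt ℂ τ z)
    (h : z * exp z * τ z ^ 2 + (exp z - 1 + z * exp z) * τ z = 1) {n : ℕ}
    (hn : normalizedPolynomial τ n z ≠ 0)
    (hρ : logDeriv (fun z ↦ z / (τ z * exp (τ z))) z ≠ 0) :
    z / (τ z * exp (τ z)) * logDeriv (sizePolynomial n) (z / (τ z * exp (τ z))) =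
      n * (τ z * z * exp z) + logDeriv (normalizedPolynomial τ n) z /
        logDeriv (fun z ↦ z / (τ z * exp (τ z))) z := by
  have hτ := saddleRadius_ne_zero h
  have hE := exp_ne_zero (τ z)
  have hbase : exp (τ z * (exp z - 1)) / τ z ≠ 0 := div_ne_zero (exp_ne_zero _) hτ
  have hnum : (√n : ℂ) * (n ^ 2 * sizePolynomial n (z / (τ z * exp (τ z)))) ≠ 0 :=
    (div_ne_zero_iff.1 hn).1
  have h1 : DifferentiableAt ℂ (fun z ↦ z / (τ z * exp (τ z))) z := by
    fun_prop (disch := simp_all)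
  have h2 : DifferentiableAt ℂ (sizePolynomial n ∘ fun z ↦ z / (τ z * exp (τ z))) z :=
    (differentiable_sizePolynomial n _).comp z h1
  have h3 : DifferentiableAt ℂ (fun z ↦ exp (τ z * (exp z - 1)) / τ z) z := by
    fun_prop (disch := simp_all)
  have hmark : z / (τ z * exp (τ z)) ≠ 0 := div_ne_zero hz (mul_ne_zero hτ hE)
  have hlog : logDeriv (normalizedPolynomial τ n) z =
      logDeriv (sizePolynomial n) (z / (τ z * exp (τ z))) *
        deriv (fun z ↦ z / (τ z * exp (τ z))) z -
      n * logDeriv (fun z ↦ exp (τ z * (exp z - 1)) / τ z) z := by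
    have hP := right_ne_zero_of_mul (right_ne_zero_of_mul hnum)
    have hcomp := logDeriv_comp (differentiable_sizePolynomial n _) h1
    rw [← hcomp]
    exact logDeriv_const_mul_div_const_mul_pow (left_ne_zero_of_mul hnum)
      (left_ne_zero_of_mul (right_ne_zero_of_mul hnum))
      (by exact_mod_cast n.factorial_ne_zero) h2 h3 hP hbase n
  rw [hlog, logDeriv_saddleBase hd hz h]
  have hderiv : deriv (fun z ↦ z / (τ z * exp (τ z))) z =
      z / (τ z * exp (τ z)) * logDeriv (fun z ↦ z / (τ z * exp (τ z))) z := by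
    rw [logDeriv_apply, mul_div_cancel₀ _ hmark]
  rw [hderiv]
  field_simp
  ring

lemma variance_mul_eq {a : ℝ} {τ : ℂ → ℂ} (ha : 0 < a)
    (h : ∀ᶠ z in 𝓝 (a : ℂ), DifferentiableAt ℂ τ z ∧
      z * exp z * τ z ^ 2 + (exp z - 1 + z * exp z) * τ z = 1)
    (hu : (a : ℂ) / (τ a * exp (τ a)) = 1)
    (hρ : ∀ᶠ z in 𝓝 (a : ℂ), logDeriv (fun z ↦ z / (τ z * exp (τ z))) z ≠ 0) {n : ℕ}
    (hn : ∀ᶠ z in 𝓝 (a : ℂ), normalizedPolynomial τ n z ≠ 0 ∧ DifferentiableAt ℂ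
      (fun z ↦ logDeriv (normalizedPolynomial τ n) z /
        logDeriv (fun z ↦ z / (τ z * exp (τ z))) z) z) :
    Vn n * logDeriv (fun z ↦ z / (τ z * exp (τ z))) a =
      n * deriv (fun z ↦ τ z * z * exp z) a +
        deriv (fun z ↦ logDeriv (normalizedPolynomial τ n) z /
          logDeriv (fun z ↦ z / (τ z * exp (τ z))) z) a := by
  have hd := h.self_of_nhds.1
  have hτ := saddleRadius_ne_zero h.self_of_nhds.2
  have h1 : DifferentiableAt ℂ (fun z ↦ z / (τ z * exp (τ z))) (a : ℂ) := by
    fun_prop (disch := simp_all)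
  have h0 : ∀ᶠ z in 𝓝 (a : ℂ), z ≠ 0 := eventually_ne_nhds (ofReal_ne_zero.2 ha.ne')
  have hP : sizePolynomial n 1 ≠ 0 := by
    intro hP
    refine hn.self_of_nhds.1 ?_
    simp [normalizedPolynomial, hu, hP]
  have heq : (fun z ↦ z / (τ z * exp (τ z)) *
      logDeriv (sizePolynomial n) (z / (τ z * exp (τ z)))) =ᶠ[𝓝 (a : ℂ)]
      fun z ↦ n * (τ z * z * exp z) + logDeriv (normalizedPolynomial τ n) z /
        logDeriv (fun z ↦ z / (τ z * exp (τ z))) z := by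
    filter_upwards [h, h0, hn, hρ] with z hz hz0 hzn hzρ
    exact mul_logDeriv_sizePolynomial_eq hz0 hz.1 hz.2 hzn.1 hzρ
  have hl := HasDerivAt.comp (h := fun z ↦ z / (τ z * exp (τ z))) (a : ℂ)
    (by rw [hu]; exact hasDerivAt_mul_logDeriv_sizePolynomial hP) h1.hasDerivAt
  have hr := (((hd.mul differentiableAt_id).mul
    (differentiable_exp _)).hasDerivAt.const_mul (n : ℂ)).add hn.self_of_nhds.2.hasDerivAt
  rw [logDeriv_apply, hu, div_one]
  exact hl.unique (hr.congr_of_eventuallyEq heq)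

/-- The logarithmic derivative of the mark and the derivative of the mean at the saddle are
positive reals. -/
lemma saddle_slopes {a τ₀ : ℝ} {τ : ℂ → ℂ} (ha : 0 < a) (hτ₀ : 0 < τ₀) (hτa : τ a = τ₀)
    (h : ∀ᶠ z in 𝓝 (a : ℂ), DifferentiableAt ℂ τ z ∧
      z * exp z * τ z ^ 2 + (exp z - 1 + z * exp z) * τ z = 1) :
    ∃ r m : ℝ, 0 < r ∧ 0 < m ∧ logDeriv (fun z ↦ z / (τ z * exp (τ z))) a = r ∧
      deriv (fun z ↦ τ z * z * exp z) a = m := by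
  have hd := h.self_of_nhds.1
  have hτ := saddleRadius_ne_zero h.self_of_nhds.2
  have hE : 1 + a < Real.exp a := by linarith [Real.add_one_lt_exp ha.ne']
  set N := (1 + a) * Real.exp a * τ₀ ^ 2 + (2 + a) * Real.exp a * τ₀ with hN
  set D := 2 * a * Real.exp a * τ₀ + (Real.exp a - 1 + a * Real.exp a) with hD
  have hN0 : 0 < N := by positivity
  have hD0 : 0 < D := by
    have : 0 < a * Real.exp a := by positivity
    have : 0 < 2 * a * Real.exp a * τ₀ := by positivity
    linarith
  have ht : deriv τ a = (-(N / D) : ℝ) := by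
    have := deriv_saddleRadius h
    rw [hτa] at this
    have hDc : (D : ℂ) ≠ 0 := ofReal_ne_zero.2 hD0.ne'
    push_cast
    rw [← neg_div, eq_div_iff hDc, hN, hD]
    push_cast
    linear_combination this
  refine ⟨1 / a + N / D / τ₀ + N / D, (-(N / D)) * (a * Real.exp a) + τ₀ * ((1 + a) * Real.exp a),
    by positivity, ?_, ?_, ?_⟩
  · have key : 0 < τ₀ * (1 + a) * D - a * N := by
      have : τ₀ * (1 + a) * D - a * N =
          τ₀ * ((1 + a) * a * Real.exp a * τ₀ + (Real.exp a - 1 - a)) := by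
        rw [hN, hD]; ring
      rw [this]
      have : 0 < (1 + a) * a * Real.exp a * τ₀ := by positivity
      exact mul_pos hτ₀ (by linarith)
    have : (-(N / D)) * (a * Real.exp a) + τ₀ * ((1 + a) * Real.exp a) =
        Real.exp a * (τ₀ * (1 + a) * D - a * N) / D := by
      field_simp
      ring
    rw [this]
    positivity
  · rw [logDeriv_saddleMark hd hτ (ofReal_ne_zero.2 ha.ne'), ht, hτa]
    push_cast
    ring
  · have h1 : deriv (fun z ↦ τ z * z * exp z) a = _ :=
      ((hd.hasDerivAt.mul (hasDerivAt_id (a : ℂ))).mul (hasDerivAt_exp (a : ℂ))).deriv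
    rw [h1, ht]
    simp only [id, Pi.mul_apply, hτa]
    push_cast
    ring

end asymptotics

theorem stmt_13 :
    ∃ σsq K : ℝ, 0 < σsq ∧ 0 ≤ K ∧
      ∀ n : ℕ, 1 ≤ n → |Vn n - σsq * (n : ℝ)| ≤ K := by
  obtain ⟨a, τ₀, ha, hτ₀, haτ, hsaddle⟩ := exists_saddle
  obtain ⟨τ, hτa, h⟩ := exists_saddleRadius ha hτ₀ hsaddle
  obtain ⟨c, hc, hlim⟩ := tendsto_normalizedPolynomial ha hτ₀ haτ hτa h
  obtain ⟨r, m, hr, hm, hra, hma⟩ := saddle_slopes ha hτ₀ hτa h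
  have hu : (a : ℂ) / (τ a * Complex.exp (τ a)) = 1 := by
    rw [div_eq_one_iff_eq (mul_ne_zero (saddleRadius_ne_zero h.self_of_nhds.2)
      (Complex.exp_ne_zero _)), hτa, haτ]
    push_cast
    rfl
  have hτan : AnalyticAt ℂ τ a :=
    Complex.analyticAt_iff_eventually_differentiableAt.2 (h.mono fun z hz ↦ hz.1)
  have hman : AnalyticAt ℂ (fun z ↦ z / (τ z * Complex.exp (τ z))) a :=
    analyticAt_id.div (hτan.mul hτan.cexp)
      (mul_ne_zero (saddleRadius_ne_zero h.self_of_nhds.2) (Complex.exp_ne_zero _))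
  have hρan : AnalyticAt ℂ (logDeriv fun z ↦ z / (τ z * Complex.exp (τ z))) a :=
    hman.deriv.div hman (by rw [hu]; exact one_ne_zero)
  have hρ0 : logDeriv (fun z ↦ z / (τ z * Complex.exp (τ z))) a ≠ 0 := by
    rw [hra]; exact Complex.ofReal_ne_zero.2 hr.ne'
  obtain ⟨K, hK⟩ := exists_norm_deriv_logDeriv_div_le
    (h.mono fun z hz n ↦ differentiableAt_normalizedPolynomial hz.1 (saddleRadius_ne_zero hz.2) n)
    hlim hc (Complex.analyticAt_iff_eventually_differentiableAt.1 hρan) hρ0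
  obtain ⟨n₀, hn₀⟩ := eventually_atTop.1 hK
  have hK0 : 0 ≤ K := (norm_nonneg _).trans (hn₀ n₀ le_rfl).1
  refine ⟨m / r, K / r + ∑ n ∈ Finset.range n₀, |Vn n - m / r * n|, by positivity, by positivity,
    fun n _ ↦ ?_⟩
  rcases lt_or_ge n n₀ with hn | hn
  · have := Finset.single_le_sum (f := fun n : ℕ ↦ |Vn n - m / r * n|) (fun _ _ ↦ abs_nonneg _)
      (Finset.mem_range.2 hn)
    have : 0 ≤ K / r := by positivity
    linarith
  · obtain ⟨h1, h2⟩ := hn₀ n hn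
    have heq := variance_mul_eq ha h hu (hρan.continuousAt.eventually_ne hρ0) h2
    rw [hra, hma] at heq
    have hnorm : |Vn n * r - n * m| ≤ K := by
      rw [← Real.norm_eq_abs, ← Complex.norm_real]
      push_cast
      rwa [heq, add_sub_cancel_left]
    have hdiv : |Vn n - m / r * n| = |Vn n * r - n * m| / r := by
      rw [← abs_of_pos hr, ← abs_div, abs_of_pos hr]
      congr 1
      field_simp
    rw [hdiv]
    have h3 := div_le_div_of_nonneg_right hnorm hr.le
    have h4 : 0 ≤ ∑ n ∈ Finset.range n₀, |Vn n - m / r * n| := by positivity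
    linarith
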